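/- arXiv:2110.13687 — 7 statements merged into one kernel-verified Lean document; each statement's English description precedes it below -/
import Mathlib

section
/- The surface S_{p,a,b} has no rational points: there is no nonzero vector (u,v,x,y,z) ∈ ℚ^5 with y² − p·x² = u·v and z² − p·x² = (u + v)(a·u + b·v). -/
theorem isSquare_intCast_of_even_padicValInt {p : ℕ} (hneg : IsSquare (-1 : ZMod p)) {n : ℤ}
    (hn : n ≠ 0)
    (h : ∀ l : ℕ, l.Prime → ¬ IsSquare (l : ZMod p) → Even (padicValInt l n)) :
    IsSquare (n : ZMod p) := by
  have hnat : IsSquare ((n.natAbs : ℕ) : ZMod p) := by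
    rw [← Nat.prod_factorization_pow_eq_self (Int.natAbs_ne_zero.mpr hn), Finsupp.prod,
      Nat.cast_prod]
    refine Finset.isSquare_prod _ fun l hl => ?_
    have hlp : l.Prime := Nat.prime_of_mem_primeFactors hl
    rw [Nat.cast_pow]
    by_cases hs : IsSquare (l : ZMod p)
    · exact hs.pow _
    · have he := h l hlp hs
      rw [padicValInt, ← Nat.factorization_def _ hlp] at he
      exact he.isSquare_pow _
  rcases Int.natAbs_eq n with h' | h' <;> rw [h']
  · rwa [Int.cast_natCast]
  · have := hneg.mul hnat
    push_cast at this ⊢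
    simpa using this

theorem dvd_and_dvd_of_dvd_sq_sub_mul_sq {l : ℕ} [Fact l.Prime] {d : ℤ}
    (hd : ¬ IsSquare (d : ZMod l)) {y x : ℤ} (h : (l : ℤ) ∣ y ^ 2 - d * x ^ 2) :
    (l : ℤ) ∣ y ∧ (l : ℤ) ∣ x := by
  rw [← ZMod.intCast_zmod_eq_zero_iff_dvd] at h ⊢
  rw [← ZMod.intCast_zmod_eq_zero_iff_dvd]
  push_cast at h
  have hx : (x : ZMod l) = 0 := by
    by_contra hx
    refine hd ⟨y / x, ?_⟩
    field_simp
    linear_combination -h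
  refine ⟨?_, hx⟩
  rw [hx] at h
  simpa using h

theorem not_isSquare_of_not_isSquare {p l : ℕ} [Fact p.Prime] [Fact l.Prime]
    (hp8 : p % 8 = 5) (hl2 : l ≠ 2) (hl : ¬ IsSquare (l : ZMod p)) :
    ¬ IsSquare (((p : ℕ) : ℤ) : ZMod l) := by
  rw [ZMod.exists_sq_eq_prime_iff_of_mod_four_eq_one (by lia) hl2] at hl
  exact_mod_cast hl

theorem padicValInt_sq {l : ℕ} [Fact l.Prime] (g : ℤ) :
    padicValInt l (g ^ 2) = 2 * padicValInt l g := by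
  rw [padicValInt, padicValInt, Int.natAbs_pow, padicValNat.pow]

theorem padicValInt_two_mul_of_odd {m : ℤ} (hm : ¬ 2 ∣ m) : padicValInt 2 (2 * m) = 1 := by
  have hm0 : m ≠ 0 := by rintro rfl; simp at hm
  rw [padicValInt.mul two_ne_zero hm0,
    padicValInt.eq_zero_of_not_dvd (z := m) (by exact_mod_cast hm),
    show padicValInt 2 2 = 1 from padicValInt_self (p := 2)]

theorem sq_sub_mul_sq_mod_eight {d y x : ℤ} (hd : d % 8 = 5) (hy : y % 2 = 1) (hx : x % 2 = 1) :
    (y ^ 2 - d * x ^ 2) % 8 = 4 := by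
  have hy' : y % 8 = 1 ∨ y % 8 = 3 ∨ y % 8 = 5 ∨ y % 8 = 7 := by lia
  have hx' : x % 8 = 1 ∨ x % 8 = 3 ∨ x % 8 = 5 ∨ x % 8 = 7 := by lia
  rcases hy' with h | h | h | h <;> rcases hx' with h' | h' | h' | h' <;>
    simp [Int.sub_emod, Int.mul_emod, pow_two, h, h', hd]

theorem even_padicValInt_sq_sub_mul_sq {p l : ℕ} [Fact p.Prime] [Fact l.Prime]
    (hp8 : p % 8 = 5) (hl : ¬ IsSquare (l : ZMod p)) (y x : ℤ) :
    Even (padicValInt l (y ^ 2 - (p : ℤ) * x ^ 2)) := by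
  rcases (Int.gcd y x).eq_zero_or_pos with h0 | hpos
  · obtain ⟨rfl, rfl⟩ := Int.gcd_eq_zero_iff.mp h0
    simp [padicValInt]
  obtain ⟨y', x', hc, hy, hx⟩ := Int.exists_gcd_one hpos
  set g : ℤ := (Int.gcd y x : ℤ)
  have hg : g ≠ 0 := by simp only [g]; exact_mod_cast hpos.ne'
  have hN : y ^ 2 - (p : ℤ) * x ^ 2 = g ^ 2 * (y' ^ 2 - (p : ℤ) * x' ^ 2) := by
    rw [hy, hx]; ring
  have hco : ¬ ((l : ℤ) ∣ y' ∧ (l : ℤ) ∣ x') := by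
    rintro ⟨h1, h2⟩
    have := Int.dvd_coe_gcd h1 h2
    rw [hc] at this
    exact (Fact.out : l.Prime).one_lt.ne' (by exact_mod_cast Int.eq_one_of_dvd_one (by simp) this)
  by_cases hN0 : y' ^ 2 - (p : ℤ) * x' ^ 2 = 0
  · rw [hN, hN0]; simp [padicValInt]
  rw [hN, padicValInt.mul (pow_ne_zero 2 hg) hN0, padicValInt_sq]
  refine (even_two_mul _).add ?_
  by_cases hdvd : (l : ℤ) ∣ y' ^ 2 - (p : ℤ) * x' ^ 2
  swap
  · rw [padicValInt.eq_zero_of_not_dvd hdvd]; exact Even.zero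
  by_cases hl2 : l = 2
  · subst hl2
    have hp2 : (p : ℤ) % 2 = 1 := by lia
    push_cast at hco hdvd
    have hpar : y' % 2 = x' % 2 := by
      rcases Int.emod_two_eq_zero_or_one y' with h | h <;>
      rcases Int.emod_two_eq_zero_or_one x' with h' | h' <;>
      simp [Int.dvd_iff_emod_eq_zero, Int.sub_emod, Int.mul_emod, pow_two, h, h', hp2] at hdvd ⊢
    have h8 := sq_sub_mul_sq_mod_eight (d := p) (y := y') (x := x') (by lia) (by lia) (by lia)
    obtain ⟨m, hm⟩ : ∃ m, y' ^ 2 - (p : ℤ) * x' ^ 2 = 2 * (2 * m) :=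
      ⟨(y' ^ 2 - (p : ℤ) * x' ^ 2) / 4, by lia⟩
    have hm2 : ¬ 2 ∣ m := by lia
    rw [hm, padicValInt.mul two_ne_zero (by lia), padicValInt_two_mul_of_odd hm2,
      show padicValInt 2 2 = 1 from padicValInt_self (p := 2)]
    decide
  · exact absurd (dvd_and_dvd_of_dvd_sq_sub_mul_sq
      (not_isSquare_of_not_isSquare hp8 hl2 hl) hdvd) hco

theorem even_padicValInt_left {p l : ℕ} [Fact p.Prime] [Fact l.Prime]
    (hp8 : p % 8 = 5) (hl : ¬ IsSquare (l : ZMod p)) {u v x y : ℤ}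
    (huv : ¬ ((l : ℤ) ∣ u ∧ (l : ℤ) ∣ v)) (hu : u ≠ 0)
    (h : y ^ 2 - (p : ℤ) * x ^ 2 = u * v) : Even (padicValInt l u) := by
  by_cases hlu : (l : ℤ) ∣ u
  · have hlv : ¬ (l : ℤ) ∣ v := fun hv => huv ⟨hlu, hv⟩
    have hv : v ≠ 0 := by rintro rfl; simp at hlv
    have := even_padicValInt_sq_sub_mul_sq hp8 hl y x
    rwa [h, padicValInt.mul hu hv, padicValInt.eq_zero_of_not_dvd hlv, add_zero] at this
  · rw [padicValInt.eq_zero_of_not_dvd hlu]; exact Even.zero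

theorem odd_binary_form {a b u v : ℤ} (ha : a % 2 = 1) (hb : b % 2 = 1)
    (huv : ¬ (2 ∣ u ∧ 2 ∣ v)) : (a * u ^ 2 + (a + b - 1) * (u * v) + b * v ^ 2) % 2 = 1 := by
  have hab : (a + b - 1) % 2 = 1 := by lia
  rcases Int.emod_two_eq_zero_or_one u with h | h <;>
  rcases Int.emod_two_eq_zero_or_one v with h' | h'
  · exact absurd ⟨Int.dvd_of_emod_eq_zero h, Int.dvd_of_emod_eq_zero h'⟩ huv
  all_goals simp [Int.add_emod, Int.mul_emod, pow_two, h, h', ha, hb, hab]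

theorem even_padicValInt_mul {p l : ℕ} [Fact p.Prime] [Fact l.Prime]
    (hp8 : p % 8 = 5) (hl : ¬ IsSquare (l : ZMod p)) {a b u v x y z : ℤ}
    (ha : a % 2 = 1) (hb : b % 2 = 1)
    (h1 : (a + b - 1) ^ 2 - 4 * a * b = (p : ℤ))
    (hprim : ¬ ((l : ℤ) ∣ u ∧ (l : ℤ) ∣ v ∧ (l : ℤ) ∣ x ∧ (l : ℤ) ∣ y ∧ (l : ℤ) ∣ z))
    (hu : u ≠ 0) (hT : z - y ≠ 0)
    (e1 : y ^ 2 - (p : ℤ) * x ^ 2 = u * v)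
    (e2 : z ^ 2 - (p : ℤ) * x ^ 2 = (u + v) * (a * u + b * v)) :
    Even (padicValInt l (u * (z - y))) := by
  have hF : (z - y) * (z + y) = a * u ^ 2 + (a + b - 1) * (u * v) + b * v ^ 2 := by
    linear_combination e2 - e1
  have hlP : Prime (l : ℤ) := Nat.prime_iff_prime_int.mp Fact.out
  rw [padicValInt.mul hu hT]
  by_cases hl2 : l = 2
  · subst hl2
    push_cast at hprim
    by_cases huv : (2 : ℤ) ∣ u ∧ (2 : ℤ) ∣ v
    · obtain ⟨⟨u', rfl⟩, ⟨v', rfl⟩⟩ := huv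
      have hp2 : (p : ℤ) % 2 = 1 := by lia
      have hyx : y % 2 = x % 2 := by
        have := congrArg (· % 2) e1
        rcases Int.emod_two_eq_zero_or_one y with h | h <;>
        rcases Int.emod_two_eq_zero_or_one x with h' | h' <;>
        simp [Int.sub_emod, Int.mul_emod, pow_two, h, h', hp2] at this ⊢
      have hzx : z % 2 = x % 2 := by
        have := congrArg (· % 2) e2
        rw [← mul_add 2] at this
        rcases Int.emod_two_eq_zero_or_one z with h | h <;>
        rcases Int.emod_two_eq_zero_or_one x with h' | h' <;>
        simp [Int.sub_emod, Int.mul_emod, pow_two, h, h', hp2] at this ⊢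
      have hx : x % 2 = 1 := by
        by_contra hx
        exact hprim ⟨⟨_, rfl⟩, ⟨_, rfl⟩, by lia, by lia, by lia⟩
      have h8 := sq_sub_mul_sq_mod_eight (d := p) (y := y) (x := x) (by lia) (by lia) hx
      rw [e1, show 2 * u' * (2 * v') = 4 * (u' * v') by ring] at h8
      have huv' : ¬ 2 ∣ u' * v' := by lia
      have hu' : ¬ 2 ∣ u' := fun h => huv' (h.mul_right _)
      obtain ⟨s, hs⟩ : 2 ∣ z - y := by lia
      obtain ⟨t, ht⟩ : 2 ∣ z + y := by lia
      have hst : s * t = a * u' ^ 2 + (a + b - 1) * (u' * v') + b * v' ^ 2 := by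
        rw [hs, ht] at hF
        linarith
      have hodd := odd_binary_form ha hb (u := u') (v := v') (fun h => hu' h.1)
      rw [← hst] at hodd
      have hs2 : ¬ 2 ∣ s := fun h => by
        have := h.mul_right t
        lia
      rw [hs, padicValInt_two_mul_of_odd hu', padicValInt_two_mul_of_odd hs2]
      decide
    · have hodd := odd_binary_form ha hb huv
      rw [← hF] at hodd
      have hT2 : ¬ ((2 : ℕ) : ℤ) ∣ z - y := fun h => by
        have := h.mul_right (z + y)
        push_cast at this
        lia
      rw [padicValInt.eq_zero_of_not_dvd hT2, add_zero]
      exact even_padicValInt_left hp8 hl (by exact_mod_cast huv) hu e1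
  · have hns := not_isSquare_of_not_isSquare hp8 hl2 hl
    have huv : ¬ ((l : ℤ) ∣ u ∧ (l : ℤ) ∣ v) := by
      rintro ⟨hu, hv⟩
      obtain ⟨hy, hx⟩ := dvd_and_dvd_of_dvd_sq_sub_mul_sq hns
        (show (l : ℤ) ∣ y ^ 2 - p * x ^ 2 from e1 ▸ hu.mul_right v)
      obtain ⟨hz, -⟩ := dvd_and_dvd_of_dvd_sq_sub_mul_sq hns
        (show (l : ℤ) ∣ z ^ 2 - p * x ^ 2 from e2 ▸ (dvd_add hu hv).mul_right _)
      exact hprim ⟨hu, hv, hx, hy, hz⟩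
    have hla : ¬ (l : ℤ) ∣ a := by
      intro h
      have := dvd_and_dvd_of_dvd_sq_sub_mul_sq hns (y := a + b - 1) (x := 1)
        (by rw [← h1]; exact (h.mul_right (4 * b)).trans (dvd_of_eq (by ring)))
      exact hlP.not_isUnit (isUnit_of_dvd_one this.2)
    have h2 : ¬ (l : ℤ) ∣ 2 := by
      intro h
      exact hl2 ((Nat.prime_dvd_prime_iff_eq Fact.out Nat.prime_two).mp (by exact_mod_cast h))
    have hlT : ¬ (l : ℤ) ∣ z - y := by
      intro h
      obtain ⟨hw, hv⟩ := dvd_and_dvd_of_dvd_sq_sub_mul_sq hns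
        (y := 2 * a * u + (a + b - 1) * v) (x := v)
        ((h.mul_right ((z + y) * (4 * a))).trans (dvd_of_eq (by
          linear_combination 4 * a * hF - v ^ 2 * h1)))
      have := (dvd_add_left (hv.mul_left (a + b - 1))).mp hw
      rcases hlP.dvd_or_dvd this with h | h
      · exact (hlP.dvd_or_dvd h).elim h2 hla
      · exact huv ⟨h, hv⟩
    rw [padicValInt.eq_zero_of_not_dvd hlT, add_zero]
    exact even_padicValInt_left hp8 hl huv hu e1

theorem no_primitive_solution_of_not_dvd_sub {p : ℕ} [Fact p.Prime] (hp8 : p % 8 = 5)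
    {a b u v x y z : ℤ} (ha : a % 2 = 1) (hb : b % 2 = 1)
    (h1 : (a + b - 1) ^ 2 - 4 * a * b = (p : ℤ))
    (h2 : (4 * a : ZMod p) = 1) (h3 : (4 * b : ZMod p) = 1)
    (hprim : ∀ l : ℕ, l.Prime →
      ¬ ((l : ℤ) ∣ u ∧ (l : ℤ) ∣ v ∧ (l : ℤ) ∣ x ∧ (l : ℤ) ∣ y ∧ (l : ℤ) ∣ z))
    (hpu : ¬ (p : ℤ) ∣ u) (hpT : ¬ (p : ℤ) ∣ z - y)
    (e1 : y ^ 2 - (p : ℤ) * x ^ 2 = u * v)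
    (e2 : z ^ 2 - (p : ℤ) * x ^ 2 = (u + v) * (a * u + b * v)) : False := by
  have hu : u ≠ 0 := by rintro rfl; simp at hpu
  have hT : z - y ≠ 0 := by intro h; simp [h] at hpT
  have hneg : IsSquare (-1 : ZMod p) := ZMod.exists_sq_eq_neg_one_iff.mpr (by lia)
  have hsq := isSquare_intCast_of_even_padicValInt hneg (mul_ne_zero hu hT) fun l hl hls => by
    have := Fact.mk hl
    exact even_padicValInt_mul hp8 hls ha hb h1 (hprim l hl) hu hT e1 e2
  have e1' : (y : ZMod p) ^ 2 = u * v := by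
    have := congrArg (Int.cast : ℤ → ZMod p) e1
    push_cast at this
    simpa using this
  have e2' : (2 * z : ZMod p) ^ 2 = (u + v) ^ 2 := by
    have := congrArg (Int.cast : ℤ → ZMod p) e2
    push_cast at this
    simp only [CharP.cast_eq_zero, zero_mul, sub_zero] at this
    linear_combination 4 * this + (u + v) * (u * h2 + v * h3)
  have hsq2 : IsSquare (2 * (u * (z - y) : ℤ) : ZMod p) := by
    push_cast
    rcases sq_eq_sq_iff_eq_or_eq_neg.mp e2' with h | h
    · exact ⟨u - y, by linear_combination u * h - e1'⟩
    · obtain ⟨i, hi⟩ := hneg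
      exact ⟨i * (u + y), by linear_combination u * h + e1' + (u + y) ^ 2 * hi⟩
  have hne : ((u * (z - y) : ℤ) : ZMod p) ≠ 0 := by
    rw [Ne, ZMod.intCast_zmod_eq_zero_iff_dvd]
    exact (Nat.prime_iff_prime_int.mp Fact.out).not_dvd_mul hpu hpT
  have htwo : IsSquare (2 : ZMod p) := by
    have := hsq2.div hsq
    rwa [mul_div_cancel_right₀ _ hne] at this
  rw [ZMod.exists_sq_eq_two_iff (by lia)] at htwo
  lia

theorem no_primitive_solution_of_not_dvd {p : ℕ} [Fact p.Prime] (hp8 : p % 8 = 5)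
    {a b u v x y z : ℤ} (ha : a % 2 = 1) (hb : b % 2 = 1)
    (h1 : (a + b - 1) ^ 2 - 4 * a * b = (p : ℤ))
    (h2 : (4 * a : ZMod p) = 1) (h3 : (4 * b : ZMod p) = 1)
    (hprim : ∀ l : ℕ, l.Prime →
      ¬ ((l : ℤ) ∣ u ∧ (l : ℤ) ∣ v ∧ (l : ℤ) ∣ x ∧ (l : ℤ) ∣ y ∧ (l : ℤ) ∣ z))
    (hpu : ¬ (p : ℤ) ∣ u)
    (e1 : y ^ 2 - (p : ℤ) * x ^ 2 = u * v)
    (e2 : z ^ 2 - (p : ℤ) * x ^ 2 = (u + v) * (a * u + b * v)) : False := by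
  by_cases hm : (p : ℤ) ∣ z - y
  swap
  · exact no_primitive_solution_of_not_dvd_sub hp8 ha hb h1 h2 h3 hprim hpu hm e1 e2
  by_cases hs : (p : ℤ) ∣ z - -y
  swap
  · exact no_primitive_solution_of_not_dvd_sub hp8 ha hb h1 h2 h3 (y := -y)
      (by simpa only [dvd_neg] using hprim) hpu hs (by simpa using e1) e2
  rw [← ZMod.intCast_zmod_eq_zero_iff_dvd] at hm hs hpu
  push_cast at hm hs
  have e1' := congrArg (Int.cast : ℤ → ZMod p) e1
  have e2' := congrArg (Int.cast : ℤ → ZMod p) e2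
  push_cast at e1' e2'
  simp only [CharP.cast_eq_zero, zero_mul, sub_zero] at e1' e2'
  have htwo : (2 : ZMod p) ≠ 0 := by
    intro h
    have : p ∣ 2 := by rw [← ZMod.natCast_eq_zero_iff]; exact_mod_cast h
    have := Nat.le_of_dvd two_pos this
    lia
  have hy : (y : ZMod p) = 0 := by
    have : (2 : ZMod p) * y = 0 := by linear_combination hs - hm
    simpa [htwo] using this
  have hz : (z : ZMod p) = 0 := by linear_combination hm + hy
  rw [hy] at e1'
  rw [hz] at e2'
  have huv : (v : ZMod p) = 0 := by simpa [hpu] using e1'.symm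
  have : (u : ZMod p) ^ 2 = 0 := by
    rw [huv] at e2'
    linear_combination -4 * e2' - u ^ 2 * h2
  exact hpu (by simpa using this)

theorem no_primitive_solution {p : ℕ} [Fact p.Prime] (hp8 : p % 8 = 5)
    {a b u v x y z : ℤ} (ha : a % 2 = 1) (hb : b % 2 = 1)
    (h1 : (a + b - 1) ^ 2 - 4 * a * b = (p : ℤ))
    (h2 : (4 * a : ZMod p) = 1) (h3 : (4 * b : ZMod p) = 1)
    (hprim : ∀ l : ℕ, l.Prime →
      ¬ ((l : ℤ) ∣ u ∧ (l : ℤ) ∣ v ∧ (l : ℤ) ∣ x ∧ (l : ℤ) ∣ y ∧ (l : ℤ) ∣ z))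
    (e1 : y ^ 2 - (p : ℤ) * x ^ 2 = u * v)
    (e2 : z ^ 2 - (p : ℤ) * x ^ 2 = (u + v) * (a * u + b * v)) : False := by
  by_cases hpu : (p : ℤ) ∣ u
  swap
  · exact no_primitive_solution_of_not_dvd hp8 ha hb h1 h2 h3 hprim hpu e1 e2
  by_cases hpv : (p : ℤ) ∣ v
  swap
  · exact no_primitive_solution_of_not_dvd hp8 hb ha (by linarith) h3 h2 (u := v) (v := u)
      (fun l hl h => hprim l hl ⟨h.2.1, h.1, h.2.2⟩) hpv (by linarith)
      (by linarith)
  have hpP : Prime (p : ℤ) := Nat.prime_iff_prime_int.mp Fact.out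
  have hy : (p : ℤ) ∣ y := hpP.dvd_of_dvd_pow (n := 2)
    ((dvd_sub_left (dvd_mul_right _ _)).mp (e1 ▸ hpu.mul_right v))
  have hz : (p : ℤ) ∣ z := hpP.dvd_of_dvd_pow (n := 2)
    ((dvd_sub_left (dvd_mul_right _ _)).mp (e2 ▸ (dvd_add hpu hpv).mul_right _))
  have hx : (p : ℤ) ∣ x := by
    refine hpP.dvd_of_dvd_pow (n := 2) ?_
    obtain ⟨u', rfl⟩ := hpu
    obtain ⟨v', rfl⟩ := hpv
    obtain ⟨y', rfl⟩ := hy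
    exact ⟨y' ^ 2 - u' * v', mul_left_cancel₀ hpP.ne_zero (by linear_combination -e1)⟩
  exact hprim p Fact.out ⟨hpu, hpv, hx, hy, hz⟩

theorem exists_primitive_int_multiple {ι : Type*} [Fintype ι] {f : ι → ℚ} (hf : f ≠ 0) :
    ∃ (c : ℚ) (g : ι → ℤ), (∀ i, c * f i = g i) ∧
      ∀ l : ℕ, l.Prime → ¬ ∀ i, (l : ℤ) ∣ g i := by
  obtain ⟨i₀, hi₀⟩ := Function.ne_iff.mp hf
  obtain ⟨m, hm⟩ := IsLocalization.exist_integer_multiples_of_finite (nonZeroDivisors ℤ) f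
  choose F hF using hm
  obtain ⟨g, hg, hg1⟩ := Finset.extract_gcd F ⟨i₀, Finset.mem_univ i₀⟩
  have hm0 : ((m : ℤ) : ℚ) ≠ 0 := by exact_mod_cast nonZeroDivisors.coe_ne_zero m
  have hF' : ∀ i, (m : ℤ) * f i = (Finset.univ.gcd F : ℤ) * (g i : ℚ) := fun i => by
    have h := hF i
    rw [hg i (Finset.mem_univ i)] at h
    simpa [Submonoid.smul_def] using h.symm
  have hD : ((Finset.univ.gcd F : ℤ) : ℚ) ≠ 0 := fun h => by
    have := hF' i₀
    rw [h, zero_mul] at this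
    exact (mul_ne_zero hm0 hi₀) this
  refine ⟨(m : ℤ) / (Finset.univ.gcd F : ℤ), g, fun i => ?_, fun l hl h => ?_⟩
  · rw [div_mul_eq_mul_div, hF' i, mul_div_cancel_left₀ _ hD]
  · have := Finset.dvd_gcd (s := Finset.univ) (f := g) fun i _ => h i
    rw [hg1] at this
    exact (Nat.prime_iff_prime_int.mp hl).not_isUnit (isUnit_of_dvd_one this)

/-- For an odd prime `p` and integers `a, b` with
`(a + b − 1)² − 4ab = p`, `4a ≡ 4b ≡ 1 (mod p)`, `a ≡ b ≡ 1 (mod 2)` and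
`a ≡ 1 (mod 8)`, the surface `S_{p,a,b}` has no rational points. -/
theorem stmt_13 (p : ℕ) (hp : p.Prime) (hpodd : p ≠ 2)
    (a b : ℤ)
    (h1 : (a + b - 1) ^ 2 - 4 * a * b = (p : ℤ))
    (h2 : 4 * a ≡ 1 [ZMOD (p : ℤ)]) (h3 : 4 * b ≡ 1 [ZMOD (p : ℤ)])
    (h4 : a ≡ 1 [ZMOD 2]) (h5 : b ≡ 1 [ZMOD 2]) (h6 : a ≡ 1 [ZMOD 8]) :
    ¬ ∃ u v x y z : ℚ,
      ¬ (u = 0 ∧ v = 0 ∧ x = 0 ∧ y = 0 ∧ z = 0) ∧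
      y ^ 2 - (p : ℚ) * x ^ 2 = u * v ∧
      z ^ 2 - (p : ℚ) * x ^ 2 = (u + v) * ((a : ℚ) * u + (b : ℚ) * v) := by
  rintro ⟨u, v, x, y, z, hne, e1, e2⟩
  have := Fact.mk hp
  have ha : a % 2 = 1 := h4
  have hb : b % 2 = 1 := h5
  have hp8 : p % 8 = 5 := by
    obtain ⟨m, rfl⟩ : ∃ m, a = 2 * m + 1 := ⟨a / 2, by lia⟩
    obtain ⟨n, rfl⟩ : ∃ n, b = 2 * n + 1 := ⟨b / 2, by lia⟩
    obtain ⟨k, hk⟩ := Int.even_mul_succ_self (m + n)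
    have : (p : ℤ) = 8 * (k - 2 * m * n - m - n - 1) + 5 := by
      linear_combination -h1 + 4 * hk
    lia
  have h2' : (4 * a : ZMod p) = 1 := by exact_mod_cast (ZMod.intCast_eq_intCast_iff _ _ p).mpr h2
  have h3' : (4 * b : ZMod p) = 1 := by exact_mod_cast (ZMod.intCast_eq_intCast_iff _ _ p).mpr h3
  obtain ⟨c, g, hg, hprim⟩ := exists_primitive_int_multiple (f := ![u, v, x, y, z]) fun h =>
    hne ⟨congrFun h 0, congrFun h 1, congrFun h 2, congrFun h 3, congrFun h 4⟩
  simp only [Fin.forall_fin_succ, IsEmpty.forall_iff, and_true] at hg hprim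
  obtain ⟨gu, gv, gx, gy, gz⟩ := hg
  refine no_primitive_solution hp8 ha hb h1 h2' h3' hprim ?_ ?_ <;>
    qify <;> rw [← gu, ← gv, ← gx] <;> simp only [← gy, ← gz] <;> simp
  · linear_combination c ^ 2 * e1
  · linear_combination c ^ 2 * e2
end

section
/- The surface S_{p,a,b} is everywhere locally soluble: there is a nonzero vector (u,v,x,y,z) ∈ ℝ^5 satisfying y² − p·x² = u·v and z² − p·x² = (u + v)(a·u + b·v), and for every prime q there is a nonzero vector (u,v,x,y,z) ∈ ℚ_q^5 satisfying the same two equations. (Together with S_{p,a,b}(ℚ) = ∅ this shows that S_{p,a,b} fails the Hasse principle.) -/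
/-- The surface `S_{p,a,b}` has a nonzero solution vector with coordinates in `R`. -/
def HasNonzeroPoint {R : Type*} [CommRing R] (p a b : R) : Prop :=
  ∃ u v x y z : R, ¬ (u = 0 ∧ v = 0 ∧ x = 0 ∧ y = 0 ∧ z = 0) ∧
    y ^ 2 - p * x ^ 2 = u * v ∧ z ^ 2 - p * x ^ 2 = (u + v) * (a * u + b * v)

namespace HasNonzeroPoint

section CommRing

variable {R : Type*} [CommRing R] {p a b : R}

theorem map {S : Type*} [CommRing S] (f : R →+* S) (hf : Function.Injective f)
    (h : HasNonzeroPoint p a b) : HasNonzeroPoint (f p) (f a) (f b) := by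
  obtain ⟨u, v, x, y, z, h0, h1, h2⟩ := h
  refine ⟨f u, f v, f x, f y, f z, ?_, ?_, ?_⟩
  · simpa only [map_eq_zero_iff f hf] using h0
  · simpa using congrArg f h1
  · simpa using congrArg f h2

variable [Nontrivial R]

theorem of_isSquare_p (h : IsSquare p) : HasNonzeroPoint p a b := by
  obtain ⟨r, rfl⟩ := h
  exact ⟨0, 0, 1, r, r, by simp, by ring, by ring⟩

theorem of_isSquare_a (h : IsSquare a) : HasNonzeroPoint p a b := by
  obtain ⟨r, rfl⟩ := h
  exact ⟨1, 0, 0, 0, r, by simp, by ring, by ring⟩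

theorem of_isSquare_b (h : IsSquare b) : HasNonzeroPoint p a b := by
  obtain ⟨r, rfl⟩ := h
  exact ⟨0, 1, 0, 0, r, by simp, by ring, by ring⟩

theorem of_isSquare_neg_one (h : IsSquare (-1 : R)) : HasNonzeroPoint p a b := by
  obtain ⟨r, hr⟩ := h
  exact ⟨1, -1, 0, r, 0, by simp, by linear_combination -hr, by ring⟩

end CommRing

section TwoSquareClasses

variable {R : Type*} [CommRing R] [IsDomain R] {p a b : R}

/-- The case `p = -c²`, `a = -m²`, `b = -n²` in which `-1` and `(m + n)² + 1` are nonsquare units. -/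
theorem of_sq_add_one_not_isSquare
    (hsq : ∀ x y : R, IsUnit x → IsUnit y → ¬ IsSquare x → ¬ IsSquare y → IsSquare (x * y))
    (hneg : ¬ IsSquare (-1 : R)) {c m n : R} (hc : c ≠ 0)
    (hm : IsUnit m) (hn : IsUnit n) (hA : IsUnit ((m + n) ^ 2 + 1))
    (hA' : ¬ IsSquare ((m + n) ^ 2 + 1)) :
    HasNonzeroPoint (-(c * c)) (-(m * m)) (-(n * n)) := by
  have hcn : c * n ≠ 0 := mul_ne_zero hc hn.ne_zero
  by_cases hmn : IsSquare (m * n)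
  · obtain ⟨w, hw⟩ := hmn
    obtain ⟨s, hs⟩ := hsq _ _ isUnit_one.neg hA hneg hA'
    refine ⟨c * n, c * m, w, 0, c * w * s, fun h => hcn h.1, ?_, ?_⟩
    · linear_combination -c ^ 2 * hw
    · linear_combination -c ^ 2 * w ^ 2 * hs - c ^ 2 * (-((m + n) ^ 2 + 1) + 1) * hw
  · obtain ⟨t, ht⟩ := hsq _ _ (hm.mul hn) hA hmn hA'
    obtain ⟨w, hw⟩ := hsq _ _ isUnit_one.neg (hm.mul hn) hneg hmn
    refine ⟨c * n, c * m, (m + n) * w, c * t, 0, fun h => hcn h.1, ?_, ?_⟩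
    · linear_combination -c ^ 2 * ht - c ^ 2 * (m + n) ^ 2 * hw
    · linear_combination -c ^ 2 * (m + n) ^ 2 * hw

theorem of_isUnit
    (hsq : ∀ x y : R, IsUnit x → IsUnit y → ¬ IsSquare x → ¬ IsSquare y → IsSquare (x * y))
    (hp : IsUnit p) (ha : IsUnit a) (hb : IsUnit b)
    (h : (a + b - 1) ^ 2 - 4 * a * b = p) : HasNonzeroPoint p a b := by
  by_cases hp' : IsSquare p
  · exact of_isSquare_p hp'
  by_cases ha' : IsSquare a
  · exact of_isSquare_a ha'
  by_cases hb' : IsSquare b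
  · exact of_isSquare_b hb'
  by_cases hneg : IsSquare (-1 : R)
  · exact of_isSquare_neg_one hneg
  have root {x : R} (hx : IsUnit x) (hx' : ¬ IsSquare x) : ∃ r, IsUnit r ∧ x = -(r * r) := by
    obtain ⟨r, hr⟩ := hsq _ _ isUnit_one.neg hx hneg hx'
    have hr' : x = -(r * r) := by linear_combination -hr
    refine ⟨r, ?_, hr'⟩
    rw [hr', IsUnit.neg_iff] at hx
    exact isUnit_of_mul_isUnit_left hx
  obtain ⟨c, hc, hpc⟩ := root hp hp'
  obtain ⟨m, hm, rfl⟩ := root ha ha'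
  obtain ⟨n, hn, rfl⟩ := root hb hb'
  have hAB : ((m + n) ^ 2 + 1) * ((m + -n) ^ 2 + 1) = p := by linear_combination h
  have hU := hAB ▸ hp
  rw [hpc]
  by_cases hA : IsSquare ((m + n) ^ 2 + 1)
  · have hB : ¬ IsSquare ((m + -n) ^ 2 + 1) := fun hB => hp' (hAB ▸ hA.mul hB)
    simpa using of_sq_add_one_not_isSquare hsq hneg hc.ne_zero hm hn.neg
      (isUnit_of_mul_isUnit_right hU) hB
  · exact of_sq_add_one_not_isSquare hsq hneg hc.ne_zero hm hn (isUnit_of_mul_isUnit_left hU) hA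

end TwoSquareClasses

end HasNonzeroPoint

namespace PadicInt

variable {q : ℕ} [Fact q.Prime]

theorem isSquare_of_norm_sq_sub_lt {x t : ℤ_[q]} (h : ‖t ^ 2 - x‖ < ‖2 * t‖ ^ 2) :
    IsSquare x := by
  obtain ⟨z, hz, -⟩ := hensels_lemma (F := (Polynomial.X ^ 2 - Polynomial.C x : Polynomial ℤ_[q]))
    (a := t) (by simpa [one_add_one_eq_two] using h)
  exact ⟨z, by simp at hz; linear_combination -hz⟩

theorem isUnit_iff_toZMod_ne_zero {x : ℤ_[q]} : IsUnit x ↔ toZMod x ≠ 0 := by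
  rw [ne_eq, ← RingHom.mem_ker, ker_toZMod, IsLocalRing.mem_maximalIdeal, mem_nonunits_iff, not_not]

theorem isSquare_of_isSquare_toZMod (hq : q ≠ 2) {x : ℤ_[q]} (hx : IsUnit x)
    (h : IsSquare (toZMod x)) : IsSquare x := by
  obtain ⟨r, hr⟩ := h
  obtain ⟨t, rfl⟩ := ZMod.ringHom_surjective (toZMod (p := q)) r
  have hx0 := isUnit_iff_toZMod_ne_zero.1 hx
  have h2 : (2 : ZMod q) ≠ 0 := Ring.two_ne_zero (by rwa [ZMod.ringChar_zmod_n])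
  have hu : IsUnit (2 * t) := isUnit_iff_toZMod_ne_zero.2 <| by
    rw [map_mul, map_ofNat]
    exact mul_ne_zero h2 fun h0 => hx0 (by simp [hr, h0])
  apply isSquare_of_norm_sq_sub_lt (t := t)
  rw [isUnit_iff.1 hu, one_pow, ← mem_nonunits, ← IsLocalRing.mem_maximalIdeal, ← ker_toZMod,
    RingHom.mem_ker, map_sub, hr]
  simp [sq]

theorem isSquare_mul_of_not_isSquare (hq : q ≠ 2) (x y : ℤ_[q]) (hx : IsUnit x) (hy : IsUnit y)
    (hx' : ¬ IsSquare x) (hy' : ¬ IsSquare y) : IsSquare (x * y) := by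
  have hxy := hx.mul hy
  refine isSquare_of_isSquare_toZMod hq hxy ?_
  rw [← quadraticChar_one_iff_isSquare (isUnit_iff_toZMod_ne_zero.1 hxy), map_mul, map_mul,
    quadraticChar_neg_one_iff_not_isSquare.2 fun h => hx' (isSquare_of_isSquare_toZMod hq hx h),
    quadraticChar_neg_one_iff_not_isSquare.2 fun h => hy' (isSquare_of_isSquare_toZMod hq hy h)]
  norm_num

theorem isSquare_intCast_of_modEq_one {a : ℤ} (h : a ≡ 1 [ZMOD 8]) : IsSquare (a : ℤ_[2]) := by
  apply isSquare_of_norm_sq_sub_lt (t := 1)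
  have h8 := (norm_int_le_pow_iff_dvd (p := 2) (k := 1 - a) (n := 3)).2 (by exact_mod_cast h.dvd)
  have h2 : ‖(2 : ℤ_[2])‖ = 2⁻¹ := by simpa using norm_p (p := 2)
  push_cast at h8
  rw [one_pow, mul_one, h2]
  exact h8.trans_lt (by norm_num)

theorem isSquare_intCast_of_four_mul_modEq_one {a : ℤ} (h : 4 * a ≡ 1 [ZMOD q]) :
    IsSquare (a : ℤ_[q]) := by
  have h1 : ((4 * a : ℤ) : ZMod q) = 1 := by
    simpa using (ZMod.intCast_eq_intCast_iff _ _ _).2 h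
  have hu : IsUnit ((4 * a : ℤ) : ℤ_[q]) := isUnit_iff_toZMod_ne_zero.2 (by rw [map_intCast, h1]; exact one_ne_zero)
  apply isSquare_of_norm_sq_sub_lt (t := 2 * (a : ℤ_[q]))
  have e : 2 * (2 * (a : ℤ_[q])) = ((4 * a : ℤ) : ℤ_[q]) := by push_cast; ring
  rw [e, isUnit_iff.1 hu, one_pow, ← mem_nonunits, ← IsLocalRing.mem_maximalIdeal, ← ker_toZMod,
    RingHom.mem_ker]
  have e' : (2 * (a : ℤ_[q])) ^ 2 - a = a * ((4 * a : ℤ) - 1) := by push_cast; ring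
  rw [e', map_mul, map_sub, map_intCast, map_intCast, h1]
  simp

end PadicInt

theorem hasNonzeroPoint_padicInt {p : ℕ} (hp : p.Prime) {a b : ℤ}
    (h1 : (a + b - 1) ^ 2 - 4 * a * b = (p : ℤ)) (h2 : 4 * a ≡ 1 [ZMOD (p : ℤ)])
    (h6 : a ≡ 1 [ZMOD 8]) (q : ℕ) [Fact q.Prime] :
    HasNonzeroPoint (p : ℤ_[q]) (a : ℤ_[q]) (b : ℤ_[q]) := by
  by_cases hq : q = 2
  · subst hq
    exact .of_isSquare_a (PadicInt.isSquare_intCast_of_modEq_one h6)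
  by_cases hqp : q = p
  · subst hqp
    exact .of_isSquare_a (PadicInt.isSquare_intCast_of_four_mul_modEq_one h2)
  have hdisc : ((a : ZMod q) + b - 1) ^ 2 - 4 * a * b = p := by exact_mod_cast congrArg (Int.cast : ℤ → ZMod q) h1
  have hpu : IsUnit (p : ℤ_[q]) := PadicInt.isUnit_iff_toZMod_ne_zero.2 <| by
    rw [map_natCast, ne_eq, ZMod.natCast_eq_zero_iff, Nat.prime_dvd_prime_iff_eq Fact.out hp]
    exact hqp
  by_cases hab : (a : ZMod q) * b = 0
  · refine .of_isSquare_p (PadicInt.isSquare_of_isSquare_toZMod hq hpu ⟨(a : ZMod q) + b - 1, ?_⟩)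
    rw [map_natCast]
    linear_combination -hdisc - 4 * hab
  · refine .of_isUnit (PadicInt.isSquare_mul_of_not_isSquare hq) hpu ?_ ?_
      (by exact_mod_cast congrArg (Int.cast : ℤ → ℤ_[q]) h1) <;>
    rw [PadicInt.isUnit_iff_toZMod_ne_zero, map_intCast]
    · exact left_ne_zero_of_mul hab
    · exact right_ne_zero_of_mul hab


/-- Under the conditions of Definition 5.1, the surface `S_{p,a,b}` is
everywhere locally soluble: it has a real point and a `ℚ_q`-point for every prime `q`. -/
theorem stmt_14 (p : ℕ) (hp : p.Prime) (hpodd : p ≠ 2)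
    (a b : ℤ)
    (h1 : (a + b - 1) ^ 2 - 4 * a * b = (p : ℤ))
    (h2 : 4 * a ≡ 1 [ZMOD (p : ℤ)]) (h3 : 4 * b ≡ 1 [ZMOD (p : ℤ)])
    (h4 : a ≡ 1 [ZMOD 2]) (h5 : b ≡ 1 [ZMOD 2]) (h6 : a ≡ 1 [ZMOD 8]) :
    (∃ u v x y z : ℝ,
      ¬ (u = 0 ∧ v = 0 ∧ x = 0 ∧ y = 0 ∧ z = 0) ∧
      y ^ 2 - (p : ℝ) * x ^ 2 = u * v ∧
      z ^ 2 - (p : ℝ) * x ^ 2 = (u + v) * ((a : ℝ) * u + (b : ℝ) * v)) ∧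
    ∀ (q : ℕ) [Fact q.Prime], ∃ u v x y z : ℚ_[q],
      ¬ (u = 0 ∧ v = 0 ∧ x = 0 ∧ y = 0 ∧ z = 0) ∧
      y ^ 2 - (p : ℚ_[q]) * x ^ 2 = u * v ∧
      z ^ 2 - (p : ℚ_[q]) * x ^ 2 = (u + v) * ((a : ℚ_[q]) * u + (b : ℚ_[q]) * v) := by
  refine ⟨HasNonzeroPoint.of_isSquare_p ⟨√(p : ℝ), (Real.mul_self_sqrt p.cast_nonneg).symm⟩, fun q _ => ?_⟩
  have h := (hasNonzeroPoint_padicInt hp h1 h2 h6 q).map PadicInt.Coe.ringHom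
    Subtype.coe_injective
  simpa only [map_natCast, map_intCast, HasNonzeroPoint] using h
end

section
/- Let p be a prime with p ≡ 5 (mod 8) and let t be an integer with t ≡ 3·(p−1)/4 (mod 8). Set a = t²·p² − t·p − (p−1)/4 and b = t²·p² + t·p − (p−1)/4. Then (a + b − 1)² − 4·a·b = p, 4a ≡ 1 (mod p), 4b ≡ 1 (mod p), a and b are both odd, and a ≡ 1 (mod 8). (In particular, triples (p, a, b) satisfying the conditions of Definition 5.1 of the paper exist for every prime p ≡ 5 (mod 8).) -/
/-- For a prime `p ≡ 5 (mod 8)` and an integer `t ≡ 3·(p−1)/4 (mod 8)`,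
the integers `a = t²p² − tp − (p−1)/4` and `b = t²p² + tp − (p−1)/4` satisfy
`(a + b − 1)² − 4ab = p`, `4a ≡ 4b ≡ 1 (mod p)`, `a` and `b` odd, and `a ≡ 1 (mod 8)`. -/
theorem stmt_15 (p : ℕ) (hp : p.Prime) (hp8 : p % 8 = 5)
    (t : ℤ) (ht : t ≡ 3 * (((p : ℤ) - 1) / 4) [ZMOD 8])
    (a b : ℤ)
    (hadef : a = t ^ 2 * (p : ℤ) ^ 2 - t * (p : ℤ) - ((p : ℤ) - 1) / 4)
    (hbdef : b = t ^ 2 * (p : ℤ) ^ 2 + t * (p : ℤ) - ((p : ℤ) - 1) / 4) :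
    (a + b - 1) ^ 2 - 4 * a * b = (p : ℤ) ∧
    4 * a ≡ 1 [ZMOD (p : ℤ)] ∧ 4 * b ≡ 1 [ZMOD (p : ℤ)] ∧
    Odd a ∧ Odd b ∧ a ≡ 1 [ZMOD 8] := by
  obtain ⟨m, hm⟩ : ∃ m : ℤ, (p : ℤ) = 8 * m + 5 := ⟨(p : ℤ) / 8, by omega⟩
  have hk : ((p : ℤ) - 1) / 4 = 2 * m + 1 := by omega
  obtain ⟨j, hj⟩ : ∃ j : ℤ, t = 3 * (2 * m + 1) + 8 * j := by
    rw [hk] at ht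
    obtain ⟨j, hj⟩ := ht.symm.dvd
    exact ⟨j, by linarith⟩
  obtain ⟨r, hr⟩ : ∃ r : ℤ, m * (m + 1) = 2 * r := (Int.even_mul_succ_self m).two_dvd
  obtain ⟨y, hy⟩ : ∃ y : ℤ, t * (p : ℤ) = 8 * y - (2 * m + 1) :=
    ⟨6 * m ^ 2 + 8 * j * m + 5 * j + 7 * m + 2, by rw [hj, hm]; ring⟩
  rw [hk, ← mul_pow] at hadef hbdef
  have ha : a - 1 = 8 * (8 * y ^ 2 - 2 * y * (2 * m + 1) - y + r) := by
    rw [hadef, hy]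
    linear_combination 4 * hr
  refine ⟨?_, ?_, ?_, ?_, ?_, ?_⟩
  · rw [hadef, hbdef]
    linear_combination -hm
  · refine (Int.modEq_iff_dvd.mpr ⟨4 * t ^ 2 * p - 4 * t - 1, ?_⟩).symm
    rw [hadef]
    linear_combination hm
  · refine (Int.modEq_iff_dvd.mpr ⟨4 * t ^ 2 * p + 4 * t - 1, ?_⟩).symm
    rw [hbdef]
    linear_combination hm
  · exact ⟨4 * (8 * y ^ 2 - 2 * y * (2 * m + 1) - y + r), by linarith⟩
  · refine ⟨32 * y ^ 2 - 8 * y * (2 * m + 1) + 4 * y - (2 * m + 1) + 4 * r, ?_⟩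
    rw [hbdef, hy]
    linear_combination 4 * hr
  · exact (Int.modEq_iff_dvd.mpr ⟨_, ha⟩).symm
end

section
/- Let (u, v, x, y, z) ∈ ℤ_p^5 with u a unit in ℤ_p, satisfying y² − p·x² = u·v and z² − p·x² = (u + v)(a·u + b·v). Then there exists ε ∈ {1, −1} such that the reduction of u·(z + ε·y) modulo p is a nonzero non-square in F_p. -/
/-- If `y² = u v` and `(2 z)² = (u + v)²` in a field of characteristic not two in which
`-1` is a square and `2` is not, and `u ≠ 0`, then one of `u (z + y)`, `u (z - y)` is a nonzero
non-square. -/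
theorem exists_sign_not_isSquare {K : Type*} [Field K] (h_two : ¬ IsSquare (2 : K))
    (h_neg : IsSquare (-1 : K)) {u v y z : K} (hu : u ≠ 0) (hy : y ^ 2 = u * v)
    (hz : (2 * z) ^ 2 = (u + v) ^ 2) :
    (u * (z + y) ≠ 0 ∧ ¬ IsSquare (u * (z + y))) ∨
      (u * (z - y) ≠ 0 ∧ ¬ IsSquare (u * (z - y))) := by
  have h20 : (2 : K) ≠ 0 := by
    intro h
    exact h_two (h ▸ IsSquare.zero)
  obtain ⟨i, hi⟩ := h_neg
  have key : ∀ w t : K, w ≠ 0 → (2 * t = w ^ 2 ∨ 2 * t = -w ^ 2) → t ≠ 0 ∧ ¬ IsSquare t := by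
    intro w t hw ht
    have ht0 : t ≠ 0 := by
      rintro rfl
      refine pow_ne_zero 2 hw ?_
      rcases ht with h | h
      · linear_combination -h
      · linear_combination h
    refine ⟨ht0, ?_⟩
    rintro ⟨r, rfl⟩
    have hr : r ≠ 0 := by
      rintro rfl
      simp at ht0
    rcases ht with h | h
    · refine h_two ⟨w / r, ?_⟩
      field_simp
      linear_combination h
    · refine h_two ⟨i * w / r, ?_⟩
      field_simp
      linear_combination h + w ^ 2 * hi
  have hne : u + y ≠ 0 ∨ u - y ≠ 0 := by
    by_contra! h
    have : 2 * u = 0 := by linear_combination h.1 + h.2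
    simp_all
  rcases sq_eq_sq_iff_eq_or_eq_neg.mp hz with h | h <;> rcases hne with hw | hw
  · exact Or.inl (key (u + y) _ hw (Or.inl (by linear_combination u * h - hy)))
  · exact Or.inr (key (u - y) _ hw (Or.inl (by linear_combination u * h - hy)))
  · exact Or.inr (key (u + y) _ hw (Or.inr (by linear_combination u * h + hy)))
  · exact Or.inl (key (u - y) _ hw (Or.inr (by linear_combination u * h + hy)))

/-- For `a ≡ 1 (mod 8)` and `b` odd, `(a + b - 1)² - 4 a b ≡ 5 (mod 8)`. -/
theorem sq_sub_four_mul_emod_eight {a b : ℤ} (ha : a ≡ 1 [ZMOD 8]) (hb : b ≡ 1 [ZMOD 2]) :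
    ((a + b - 1) ^ 2 - 4 * a * b) % 8 = 5 := by
  obtain ⟨k, hk⟩ := ha.symm.dvd
  obtain ⟨m, hm⟩ := hb.symm.dvd
  obtain rfl : a = 8 * k + 1 := by linarith
  obtain rfl : b = 2 * m + 1 := by linarith
  obtain ⟨n, hn⟩ : Even (m * (m - 1)) := Int.even_mul_pred_self m
  have : (8 * k + 1 + (2 * m + 1) - 1) ^ 2 - 4 * (8 * k + 1) * (2 * m + 1)
      = 8 * (8 * k ^ 2 - 4 * k * m - 2 * k + n - 1) + 5 := by
    linear_combination 4 * hn
  omega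


/-- Under the conditions of Definition 5.1 on `(p, a, b)`, for any
`(u,v,x,y,z) ∈ ℤ_p^5` with `u` a unit satisfying the equations of `S_{p,a,b}`, there
is a sign `ε = ±1` such that the reduction of `u·(z + ε·y)` modulo `p` is a nonzero
non-square in `F_p`. -/
theorem stmt_16 (p : ℕ) [Fact p.Prime] (hpodd : p ≠ 2)
    (a b : ℤ)
    (h1 : (a + b - 1) ^ 2 - 4 * a * b = (p : ℤ))
    (h2 : 4 * a ≡ 1 [ZMOD (p : ℤ)]) (h3 : 4 * b ≡ 1 [ZMOD (p : ℤ)])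
    (h4 : a ≡ 1 [ZMOD 2]) (h5 : b ≡ 1 [ZMOD 2]) (h6 : a ≡ 1 [ZMOD 8])
    (u v x y z : ℤ_[p]) (hu : IsUnit u)
    (heq1 : y ^ 2 - (p : ℤ_[p]) * x ^ 2 = u * v)
    (heq2 : z ^ 2 - (p : ℤ_[p]) * x ^ 2
      = (u + v) * ((a : ℤ_[p]) * u + (b : ℤ_[p]) * v)) :
    ∃ ε : ℤ_[p], (ε = 1 ∨ ε = -1) ∧
      PadicInt.toZMod (u * (z + ε * y)) ≠ 0 ∧
      ¬ IsSquare (PadicInt.toZMod (u * (z + ε * y))) := by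
  have hp8 : p % 8 = 5 := by
    have := sq_sub_four_mul_emod_eight h6 h5
    rw [h1] at this
    omega
  have h_two : ¬ IsSquare (2 : ZMod p) := by
    rw [ZMod.exists_sq_eq_two_iff hpodd]
    omega
  have h_neg : IsSquare (-1 : ZMod p) := by
    rw [ZMod.exists_sq_eq_neg_one_iff]
    omega
  have ha : (4 * a : ZMod p) = 1 := by
    exact_mod_cast (ZMod.intCast_eq_intCast_iff _ _ p).mpr h2
  have hb : (4 * b : ZMod p) = 1 := by
    exact_mod_cast (ZMod.intCast_eq_intCast_iff _ _ p).mpr h3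
  have e1 := congrArg PadicInt.toZMod heq1
  have e2 := congrArg PadicInt.toZMod heq2
  simp only [map_sub, map_mul, map_pow, map_add, map_natCast, map_intCast, CharP.cast_eq_zero,
    zero_mul, sub_zero] at e1 e2
  have hu0 : PadicInt.toZMod u ≠ 0 := (hu.map PadicInt.toZMod).ne_zero
  rcases exists_sign_not_isSquare h_two h_neg hu0 e1
    (z := PadicInt.toZMod z)
    (by linear_combination 4 * e2 + (PadicInt.toZMod u + PadicInt.toZMod v) *
      (PadicInt.toZMod u * ha + PadicInt.toZMod v * hb)) with h | h
  · exact ⟨1, Or.inl rfl, by simpa using h⟩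
  · exact ⟨-1, Or.inr rfl, by simpa [sub_eq_add_neg] using h⟩
end

section
/- Let p be an odd prime and let A', B', C, D, M', N' be integers such that (A'·D + B'·C − M')² − 4·A'·B'·C·D = p·N'² and such that the reduction of 2·A'·C·M'·(A'·D + B'·C − M') modulo p is a non-square in F_p (in particular it is nonzero). Then there is no nonzero vector (u,v,x,y,z) ∈ ℚ_p^5 with y² − p·x² = p·M'·u·v and z² − p·x² = p·(A'·u + B'·v)(C·u + D·v). (This is the local insolubility established in Case 2b of the proof of the main surjectivity proposition.) -/
/-- An element of `ℤ_[p]` that vanishes modulo `p` is a multiple of `p`. -/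
lemma PadicInt.exists_eq_mul_of_toZMod_eq_zero {p : ℕ} [Fact p.Prime] {a : ℤ_[p]}
    (ha : PadicInt.toZMod a = 0) : ∃ b : ℤ_[p], a = p * b := by
  have h : a ∈ RingHom.ker (PadicInt.toZMod (p := p)) := ha
  rw [PadicInt.ker_toZMod, PadicInt.maximalIdeal_eq_span_p, Ideal.mem_span_singleton] at h
  exact h

/-- Over a field, the reduced system forces `u`, `v` and `x` to vanish. -/
lemma eq_zero_of_reduced_system {F : Type*} [Field F] {A B C D M u v x : F}
    (hdisc : (A * D + B * C - M) ^ 2 - 4 * A * B * C * D = 0)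
    (hns : ¬ IsSquare (2 * A * C * M * (A * D + B * C - M)))
    (h1 : -x ^ 2 = M * u * v)
    (h2 : -x ^ 2 = (A * u + B * v) * (C * u + D * v)) :
    u = 0 ∧ v = 0 ∧ x = 0 := by
  have hAC : 2 * A * C ≠ 0 := fun h ↦ hns (by simp [h])
  have hlin : 2 * A * C * u + (A * D + B * C - M) * v = 0 := by
    refine pow_eq_zero_iff two_ne_zero |>.mp ?_
    linear_combination v ^ 2 * hdisc - 4 * A * C * (h2 - h1)
  have hv : v = 0 := by
    by_contra hv
    refine hns ⟨2 * A * C * x / v, ?_⟩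
    field_simp
    linear_combination 2 * A * C * M * v * hlin + (2 * A * C) ^ 2 * h1
  have hx : x = 0 := by simpa [hv] using h1
  have hu : u = 0 := by simpa [hv, hAC] using hlin
  exact ⟨hu, hv, hx⟩

/-- Every integral solution of the system is divisible by `p`. -/
lemma toZMod_eq_zero_of_system {p : ℕ} [Fact p.Prime] {A B C D M N : ℤ}
    (hdisc : (A * D + B * C - M) ^ 2 - 4 * A * B * C * D = (p : ℤ) * N ^ 2)
    (hns : ¬ IsSquare ((2 * A * C * M * (A * D + B * C - M) : ℤ) : ZMod p))
    {u v x y z : ℤ_[p]}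
    (h1 : y ^ 2 - p * x ^ 2 = p * M * u * v)
    (h2 : z ^ 2 - p * x ^ 2 = p * (A * u + B * v) * (C * u + D * v)) :
    PadicInt.toZMod u = 0 ∧ PadicInt.toZMod v = 0 ∧ PadicInt.toZMod x = 0 ∧
      PadicInt.toZMod y = 0 ∧ PadicInt.toZMod z = 0 := by
  have hp : (p : ℤ_[p]) ≠ 0 := by exact_mod_cast (Fact.out : p.Prime).ne_zero
  have hy : PadicInt.toZMod y = 0 := by
    simpa using congrArg PadicInt.toZMod h1
  have hz : PadicInt.toZMod z = 0 := by
    simpa using congrArg PadicInt.toZMod h2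
  obtain ⟨y', rfl⟩ := PadicInt.exists_eq_mul_of_toZMod_eq_zero hy
  obtain ⟨z', rfl⟩ := PadicInt.exists_eq_mul_of_toZMod_eq_zero hz
  have h1' : p * y' ^ 2 - x ^ 2 = M * u * v :=
    mul_left_cancel₀ hp (by linear_combination h1)
  have h2' : p * z' ^ 2 - x ^ 2 = (A * u + B * v) * (C * u + D * v) :=
    mul_left_cancel₀ hp (by linear_combination h2)
  have hdisc' := congrArg (Int.cast : ℤ → ZMod p) hdisc
  have h1'' := congrArg PadicInt.toZMod h1'
  have h2'' := congrArg PadicInt.toZMod h2'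
  push_cast at hns hdisc'
  simp only [map_sub, map_add, map_mul, map_pow, map_natCast, map_intCast, CharP.cast_eq_zero,
    zero_mul, zero_sub] at hdisc' h1'' h2''
  obtain ⟨hu, hv, hx⟩ := eq_zero_of_reduced_system hdisc' hns h1'' h2''
  exact ⟨hu, hv, hx, hy, hz⟩

/-- Let `p` be an odd prime and `A', B', C, D, M', N'` integers with
`(A'D + B'C − M')² − 4A'B'CD = p·N'²` and such that `2·A'·C·M'·(A'D + B'C − M')` reduces
to a non-square in `F_p`. Then the system `y² − p·x² = p·M'·u·v`,
`z² − p·x² = p·(A'u + B'v)(Cu + Dv)` has no nonzero solution over `ℚ_p`. -/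
theorem stmt_17 (p : ℕ) [Fact p.Prime] (hpodd : p ≠ 2)
    (A' B' C D M' N' : ℤ)
    (hC1 : (A' * D + B' * C - M') ^ 2 - 4 * A' * B' * C * D = (p : ℤ) * N' ^ 2)
    (hns : ¬ IsSquare ((2 * A' * C * M' * (A' * D + B' * C - M') : ℤ) : ZMod p)) :
    ¬ ∃ u v x y z : ℚ_[p],
      ¬ (u = 0 ∧ v = 0 ∧ x = 0 ∧ y = 0 ∧ z = 0) ∧
      y ^ 2 - (p : ℚ_[p]) * x ^ 2 = (p : ℚ_[p]) * (M' : ℚ_[p]) * u * v ∧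
      z ^ 2 - (p : ℚ_[p]) * x ^ 2
        = (p : ℚ_[p]) * ((A' : ℚ_[p]) * u + (B' : ℚ_[p]) * v)
          * ((C : ℚ_[p]) * u + (D : ℚ_[p]) * v) := by
  rintro ⟨u, v, x, y, z, hne, h1, h2⟩
  let f : Fin 5 → ℚ_[p] := ![u, v, x, y, z]
  obtain ⟨i, hi⟩ := Finite.exists_max fun j ↦ ‖f j‖
  have hfi : f i ≠ 0 := by
    intro h0
    have hf (j : Fin 5) : f j = 0 := by simpa [h0] using hi j
    exact hne ⟨hf 0, hf 1, hf 2, hf 3, hf 4⟩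
  let g : Fin 5 → ℤ_[p] := fun j ↦
    ⟨f j / f i, by
      rw [norm_div]
      exact div_le_one_of_le₀ (hi j) (norm_nonneg _)⟩
  have hg (j : Fin 5) : (g j : ℚ_[p]) = f j / f i := rfl
  have hgi : g i = 1 := Subtype.ext (div_self hfi)
  have e1 : g 3 ^ 2 - p * g 2 ^ 2 = p * M' * g 0 * g 1 := by
    apply Subtype.ext
    push_cast [hg]
    field_simp
    exact h1
  have e2 : g 4 ^ 2 - p * g 2 ^ 2 = p * (A' * g 0 + B' * g 1) * (C * g 0 + D * g 1) := by
    apply Subtype.ext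
    push_cast [hg]
    field_simp
    rw [mul_comm (f 0) (C : ℚ_[p]), mul_comm (f 1) (D : ℚ_[p])]
    exact h2
  obtain ⟨z0, z1, z2, z3, z4⟩ := toZMod_eq_zero_of_system hC1 hns e1 e2
  have hz : PadicInt.toZMod (g i) = 0 := by fin_cases i <;> assumption
  simp [hgi] at hz
end

section
/- Consider the system y² − 13·x² = u·v, z² − 13·x² = (2u − 13v)(u − 6v). There is a nonzero vector in ℝ^5 satisfying both equations, and for every prime q there is a nonzero vector in ℚ_q^5 satisfying both equations, but there is no nonzero vector in ℚ^5 satisfying both equations. (Thus the quartic del Pezzo surface Y_{13,2,6}, whose Brauer group modulo constants has order 4, fails the Hasse principle; the failure is explained by a Brauer–Manin obstruction coming from 𝒜 = (13, (u−6v)/v).) -/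
/-- If `n` is not a perfect square, then `a² = n b²` has only the trivial integral solution. -/
theorem eq_zero_of_sq_eq_mul_sq {n : ℕ} (hn : ¬ IsSquare n) {a b : ℤ}
    (h : a ^ 2 = n * b ^ 2) : a = 0 ∧ b = 0 := by
  have hb : b = 0 := by
    by_contra hb
    have hb' : (b : ℚ) ≠ 0 := by exact_mod_cast hb
    refine hn (Rat.isSquare_natCast_iff.mp ⟨a / b, ?_⟩)
    have h' : (a : ℚ) ^ 2 = n * b ^ 2 := by exact_mod_cast h
    field_simp
    linarith
  subst hb
  exact ⟨by simpa using h, rfl⟩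

/-- An integer that has even valuation at every prime that is not a square modulo a prime
`ℓ ≡ 1 (mod 4)` is a square modulo `ℓ`. -/
theorem isSquare_intCast_zmod_of_even_padicValInt {l : ℕ} [Fact l.Prime] (hl : l % 4 = 1) {n : ℤ}
    (h : ∀ p : ℕ, p.Prime → ¬ IsSquare (p : ZMod l) → Even (padicValInt p n)) :
    IsSquare (n : ZMod l) := by
  rcases eq_or_ne n 0 with rfl | hn
  · simp
  have hnat : IsSquare ((n.natAbs : ℕ) : ZMod l) := by
    rw [← Nat.prod_factorization_pow_eq_self (Int.natAbs_ne_zero.mpr hn), Finsupp.prod,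
      Nat.cast_prod]
    refine Finset.isSquare_prod _ fun p hp => ?_
    have hp' : p.Prime := Nat.prime_of_mem_primeFactors hp
    rw [Nat.cast_pow]
    by_cases hs : IsSquare (p : ZMod l)
    · exact hs.pow _
    · refine Even.isSquare_pow ?_ _
      rw [Nat.factorization_def _ hp']
      exact h p hp' hs
  have hneg : IsSquare (-1 : ZMod l) := ZMod.exists_sq_eq_neg_one_iff.mpr (by omega)
  rcases Int.natAbs_eq n with h1 | h1
  · rw [h1]
    simpa using hnat
  · rw [h1]
    simpa using hneg.mul hnat

theorem padicValInt_sq_mul {p : ℕ} [Fact p.Prime] {g m : ℤ} (hg : g ≠ 0) (hm : m ≠ 0) :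
    padicValInt p (g ^ 2 * m) = 2 * padicValInt p g + padicValInt p m := by
  rw [padicValInt.mul (pow_ne_zero 2 hg) hm, sq, padicValInt.mul hg hg]
  ring

/-- If `p` does not divide both of the nonzero integers `m`, `n` and their product has even `p`-adic
valuation, then so do both factors. -/
theorem even_padicValInt_of_mul {p : ℕ} [Fact p.Prime] {m n : ℤ} (hm : m ≠ 0) (hn : n ≠ 0)
    (hmn : ¬ ((p : ℤ) ∣ m ∧ (p : ℤ) ∣ n)) (h : Even (padicValInt p (m * n))) :
    Even (padicValInt p m) ∧ Even (padicValInt p n) := by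
  rw [padicValInt.mul hm hn] at h
  by_cases h1 : (p : ℤ) ∣ m
  · have h2 := padicValInt.eq_zero_of_not_dvd fun h2 => hmn ⟨h1, h2⟩
    rw [h2] at h ⊢
    exact ⟨h, Even.zero⟩
  · rw [padicValInt.eq_zero_of_not_dvd h1] at h ⊢
    exact ⟨Even.zero, by simpa using h⟩

/-- A prime inert in `ℚ(√13)` divides every value of the form `a² − 13b²` to even order. -/
theorem even_padicValInt_sq_sub_thirteen_mul_sq {p : ℕ} [hp : Fact p.Prime]
    (hs : ¬ IsSquare (p : ZMod 13)) (a b : ℤ) : Even (padicValInt p (a ^ 2 - 13 * b ^ 2)) := by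
  have : Fact (Nat.Prime 13) := ⟨by norm_num⟩
  induction hk : a.natAbs + b.natAbs using Nat.strong_induction_on generalizing a b with
  | _ k ih =>
  subst hk
  by_cases hz : a ^ 2 - 13 * b ^ 2 = 0
  · simp [hz]
  by_cases hd : (p : ℤ) ∣ a ∧ (p : ℤ) ∣ b
  · obtain ⟨⟨c, rfl⟩, d, rfl⟩ := hd
    have he : ((p : ℤ) * c) ^ 2 - 13 * (p * d) ^ 2 = (p : ℤ) ^ 2 * (c ^ 2 - 13 * d ^ 2) := by ring
    rw [he] at hz ⊢
    have hp0 : (p : ℤ) ≠ 0 := left_ne_zero_of_mul hz ∘ fun h => by simp [h]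
    rw [padicValInt_sq_mul hp0 (right_ne_zero_of_mul hz)]
    refine (even_two_mul _).add (ih _ ?_ c d rfl)
    have hcd : c.natAbs + d.natAbs ≠ 0 := by
      intro h
      obtain ⟨rfl, rfl⟩ : c = 0 ∧ d = 0 := by omega
      simp at hz
    rw [Int.natAbs_mul, Int.natAbs_mul, Int.natAbs_natCast, ← mul_add]
    have := hp.out.two_le
    nlinarith [Nat.pos_of_ne_zero hcd]
  by_cases hp2 : p = 2
  · subst hp2
    by_cases heven : (2 : ℤ) ∣ a ^ 2 - 13 * b ^ 2
    · have hab : Even a ↔ Even b := by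
        have h13 : ¬ Even (13 : ℤ) := by decide
        simpa [Int.even_sub, Int.even_mul, Int.even_pow, h13] using even_iff_two_dvd.mpr heven
      have hb : ¬ Even b := fun hb => hd ⟨(hab.mpr hb).two_dvd, hb.two_dvd⟩
      have ha : ¬ Even a := hab.not.mpr hb
      have h8 : ∃ m : ℤ, a ^ 2 - 13 * b ^ 2 = 2 ^ 2 * (2 * m + 1) := by
        obtain ⟨c, hc⟩ := Int.eight_dvd_sq_sub_one_of_odd (Int.not_even_iff_odd.mp ha)
        obtain ⟨d, hd⟩ := Int.eight_dvd_sq_sub_one_of_odd (Int.not_even_iff_odd.mp hb)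
        exact ⟨c - 13 * d - 2, by linarith⟩
      obtain ⟨m, hm⟩ := h8
      rw [hm, padicValInt_sq_mul two_ne_zero (by omega),
        padicValInt.eq_zero_of_not_dvd (z := 2 * m + 1) (by push_cast; omega)]
      simp
    · rw [padicValInt.eq_zero_of_not_dvd (mod_cast heven)]
      exact Even.zero
  · rw [padicValInt.eq_zero_of_not_dvd]
    · exact Even.zero
    · intro h
      have hl : legendreSym p 13 = -1 := by
        rw [legendreSym.eq_neg_one_iff]
        have := ZMod.exists_sq_eq_prime_iff_of_mod_four_eq_one (p := 13) (by norm_num) hp2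
        exact fun h13 => hs (this.mpr (mod_cast h13))
      exact hd (legendreSym.prime_dvd_of_eq_neg_one hl h)

/-- Since `2` and `-6` are not squares modulo `13`, the four linear forms of the surface cannot all
take square values at a point of the projective line over `ZMod 13`. -/
theorem eq_zero_of_isSquare_zmod_thirteen : ∀ {a b : ZMod 13}, IsSquare a → IsSquare b →
    IsSquare (2 * a - 13 * b) → IsSquare (a - 6 * b) → a = 0 ∧ b = 0 := by
  decide

/-- There is no integral solution of the twisted system with coprime `u`, `v`. -/
theorem false_of_isCoprime_of_twisted_system {u v x y z g : ℤ} (hg : g ≠ 0) (huv : IsCoprime u v)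
    (h1 : y ^ 2 - 13 * x ^ 2 = g ^ 2 * (u * v))
    (h2 : z ^ 2 - 13 * x ^ 2 = g ^ 2 * ((2 * u - 13 * v) * (u - 6 * v))) : False := by
  have : Fact (Nat.Prime 13) := ⟨by norm_num⟩
  have h13 : ¬ IsSquare 13 := by norm_num
  have h_not_both : ¬ (u = 0 ∧ v = 0) := by
    rintro ⟨rfl, rfl⟩
    exact not_isCoprime_zero_zero huv
  have hu : u ≠ 0 := by
    rintro rfl
    obtain ⟨-, rfl⟩ := eq_zero_of_sq_eq_mul_sq h13 (a := y) (b := x) (by push_cast; linarith)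
    obtain ⟨-, h⟩ := eq_zero_of_sq_eq_mul_sq (n := 78) (by norm_num) (a := z) (b := g * v)
      (by push_cast; linarith)
    exact h_not_both ⟨rfl, (mul_eq_zero.mp h).resolve_left hg⟩
  have hv : v ≠ 0 := by
    rintro rfl
    obtain ⟨-, rfl⟩ := eq_zero_of_sq_eq_mul_sq h13 (a := y) (b := x) (by push_cast; linarith)
    obtain ⟨-, h⟩ := eq_zero_of_sq_eq_mul_sq (n := 2) (by norm_num) (a := z) (b := g * u)
      (by push_cast; linarith)
    exact h_not_both ⟨(mul_eq_zero.mp h).resolve_left hg, rfl⟩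
  have hs : 2 * u - 13 * v ≠ 0 := by
    intro hs
    rw [hs] at h2
    obtain ⟨-, rfl⟩ := eq_zero_of_sq_eq_mul_sq h13 (a := z) (b := x) (by push_cast; linarith)
    obtain ⟨-, h⟩ := eq_zero_of_sq_eq_mul_sq (n := 26) (by norm_num) (a := 2 * y) (b := g * v)
      (by push_cast; linear_combination 4 * h1 + 2 * g ^ 2 * v * hs)
    exact hv ((mul_eq_zero.mp h).resolve_left hg)
  have ht : u - 6 * v ≠ 0 := by
    intro ht
    rw [ht] at h2
    obtain ⟨-, rfl⟩ := eq_zero_of_sq_eq_mul_sq h13 (a := z) (b := x) (by push_cast; linarith)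
    obtain ⟨-, h⟩ := eq_zero_of_sq_eq_mul_sq (n := 6) (by norm_num) (a := y) (b := g * v)
      (by push_cast; linear_combination h1 + g ^ 2 * v * ht)
    exact hv ((mul_eq_zero.mp h).resolve_left hg)
  have h_even : ∀ p : ℕ, p.Prime → ¬ IsSquare (p : ZMod 13) →
      (Even (padicValInt p u) ∧ Even (padicValInt p v)) ∧
        Even (padicValInt p (2 * u - 13 * v)) ∧ Even (padicValInt p (u - 6 * v)) := by
    intro p hp hps
    have := Fact.mk hp
    have h_norm : ∀ {w m : ℤ}, m ≠ 0 → w ^ 2 - 13 * x ^ 2 = g ^ 2 * m → Even (padicValInt p m) := by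
      intro w m hm hw
      have := even_padicValInt_sq_sub_thirteen_mul_sq hps w x
      rw [hw, padicValInt_sq_mul hg hm] at this
      exact (Nat.even_add.mp this).mp (even_two_mul _)
    have h_not_dvd : ¬ ((p : ℤ) ∣ u ∧ (p : ℤ) ∣ v) := fun h =>
      (Nat.prime_iff_prime_int.mp hp).not_isUnit (huv.isUnit_of_dvd' h.1 h.2)
    refine ⟨even_padicValInt_of_mul hu hv h_not_dvd (h_norm (mul_ne_zero hu hv) h1),
      even_padicValInt_of_mul hs ht (fun h => h_not_dvd ?_) (h_norm (mul_ne_zero hs ht) h2)⟩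
    have hpv : (p : ℤ) ∣ v := by
      have := (h.2.mul_left 2).sub h.1
      ring_nf at this
      exact this
    exact ⟨by simpa using h.2.add (hpv.mul_left 6), hpv⟩
  have su := isSquare_intCast_zmod_of_even_padicValInt (l := 13) rfl
    fun p hp h => (h_even p hp h).1.1
  have sv := isSquare_intCast_zmod_of_even_padicValInt (l := 13) rfl
    fun p hp h => (h_even p hp h).1.2
  have ss := isSquare_intCast_zmod_of_even_padicValInt (l := 13) rfl
    fun p hp h => (h_even p hp h).2.1
  have st := isSquare_intCast_zmod_of_even_padicValInt (l := 13) rfl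
    fun p hp h => (h_even p hp h).2.2
  push_cast at ss st
  obtain ⟨hu13, hv13⟩ := eq_zero_of_isSquare_zmod_thirteen su sv ss st
  rw [ZMod.intCast_zmod_eq_zero_iff_dvd] at hu13 hv13
  exact absurd (Int.isUnit_iff.mp (huv.isUnit_of_dvd' hu13 hv13)) (by norm_num)

theorem eq_zero_of_system_int {u v x y z : ℤ}
    (h1 : y ^ 2 - 13 * x ^ 2 = u * v)
    (h2 : z ^ 2 - 13 * x ^ 2 = (2 * u - 13 * v) * (u - 6 * v)) :
    u = 0 ∧ v = 0 ∧ x = 0 ∧ y = 0 ∧ z = 0 := by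
  by_cases huv : u = 0 ∧ v = 0
  · obtain ⟨rfl, rfl⟩ := huv
    have h13 : ¬ IsSquare 13 := by norm_num
    obtain ⟨hy, rfl⟩ := eq_zero_of_sq_eq_mul_sq h13 (a := y) (b := x) (by push_cast; linarith)
    exact ⟨rfl, rfl, rfl, hy, by simpa using h2⟩
  · exfalso
    have hg : Int.gcd u v ≠ 0 := fun h => huv (Int.gcd_eq_zero_iff.mp h)
    obtain ⟨u', v', hc, hu, hv⟩ := Int.exists_gcd_one (Nat.pos_of_ne_zero hg)
    have hg' : (Int.gcd u v : ℤ) ≠ 0 := by exact_mod_cast hg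
    generalize (Int.gcd u v : ℤ) = g at hu hv hg'
    subst hu hv
    exact false_of_isCoprime_of_twisted_system hg' (Int.isCoprime_iff_gcd_eq_one.mpr hc)
      (by rw [h1]; ring) (by rw [h2]; ring)

theorem eq_zero_of_system_rat {u v x y z : ℚ}
    (h1 : y ^ 2 - 13 * x ^ 2 = u * v)
    (h2 : z ^ 2 - 13 * x ^ 2 = (2 * u - 13 * v) * (u - 6 * v)) :
    u = 0 ∧ v = 0 ∧ x = 0 ∧ y = 0 ∧ z = 0 := by
  obtain ⟨⟨d, hd⟩, h⟩ :=
    IsLocalization.exist_integer_multiples_of_finset (nonZeroDivisors ℤ) {u, v, x, y, z}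
  obtain ⟨u', hu⟩ := h u (by simp)
  obtain ⟨v', hv⟩ := h v (by simp)
  obtain ⟨x', hx⟩ := h x (by simp)
  obtain ⟨y', hy⟩ := h y (by simp)
  obtain ⟨z', hz⟩ := h z (by simp)
  have hd0 : (d : ℚ) ≠ 0 := by exact_mod_cast nonZeroDivisors.ne_zero hd
  simp only [eq_intCast, zsmul_eq_mul] at hu hv hx hy hz
  have h1' : y' ^ 2 - 13 * x' ^ 2 = u' * v' := by
    have : (y' : ℚ) ^ 2 - 13 * x' ^ 2 = u' * v' := by
      rw [hu, hv, hx, hy]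
      linear_combination (d : ℚ) ^ 2 * h1
    exact_mod_cast this
  have h2' : z' ^ 2 - 13 * x' ^ 2 = (2 * u' - 13 * v') * (u' - 6 * v') := by
    have : (z' : ℚ) ^ 2 - 13 * x' ^ 2 = (2 * u' - 13 * v') * (u' - 6 * v') := by
      rw [hu, hv, hx, hz]
      linear_combination (d : ℚ) ^ 2 * h2
    exact_mod_cast this
  obtain ⟨rfl, rfl, rfl, rfl, rfl⟩ := eq_zero_of_system_int h1' h2'
  simp only [Int.cast_zero, zero_eq_mul, hd0, false_or] at hu hv hx hy hz
  exact ⟨hu, hv, hx, hy, hz⟩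

/-- Hensel's lemma for square roots of an integer. -/
theorem exists_padic_sq_eq_intCast {p : ℕ} [Fact p.Prime] {n a : ℤ}
    (h : ‖((a ^ 2 - n : ℤ) : ℤ_[p])‖ < ‖((2 * a : ℤ) : ℤ_[p])‖ ^ 2) :
    ∃ z : ℚ_[p], z ^ 2 = n := by
  obtain ⟨z, hz, -⟩ := hensels_lemma (F := (Polynomial.X ^ 2 - Polynomial.C n : Polynomial ℤ))
    (a := (a : ℤ_[p])) (by simpa [map_ofNat] using h)
  refine ⟨z, ?_⟩
  have hz' : z ^ 2 = n := by simpa [sub_eq_zero] using hz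
  exact_mod_cast congrArg (fun t : ℤ_[p] => (t : ℚ_[p])) hz'

theorem exists_padic_sq_eq_intCast_of_isSquare {p : ℕ} [Fact p.Prime] (hp : p ≠ 2) {n : ℤ}
    (hn : (n : ZMod p) ≠ 0) (h : IsSquare (n : ZMod p)) : ∃ z : ℚ_[p], z ^ 2 = n := by
  obtain ⟨b, hb⟩ := h
  obtain ⟨a, rfl⟩ := ZMod.intCast_surjective b
  refine exists_padic_sq_eq_intCast (a := a) ?_
  have h2 : ‖((2 * a : ℤ) : ℤ_[p])‖ = 1 := by
    refine le_antisymm (PadicInt.norm_le_one _) (not_lt.mp fun hlt => ?_)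
    rw [PadicInt.norm_int_lt_one_iff_dvd, ← ZMod.intCast_zmod_eq_zero_iff_dvd] at hlt
    push_cast at hlt
    have h2' : (2 : ZMod p) ≠ 0 := Ring.two_ne_zero (by rwa [ZMod.ringChar_zmod_n])
    rw [(mul_eq_zero.mp hlt).resolve_left h2', mul_zero] at hb
    exact hn hb
  rw [h2, one_pow, PadicInt.norm_int_lt_one_iff_dvd, ← ZMod.intCast_zmod_eq_zero_iff_dvd]
  push_cast
  rw [hb]
  ring

/-- Away from `2` and `13`, one of `2`, `13`, `26` is a `q`-adic square. -/
theorem exists_padic_sq_eq_two_or_thirteen_or_twentySix {q : ℕ} [hq : Fact q.Prime] (h2 : q ≠ 2)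
    (h13 : q ≠ 13) :
    (∃ w : ℚ_[q], w ^ 2 = 2) ∨ (∃ w : ℚ_[q], w ^ 2 = 13) ∨ ∃ w : ℚ_[q], w ^ 2 = 26 := by
  have : Fact (Nat.Prime 13) := ⟨by norm_num⟩
  have hz2 : ((2 : ℤ) : ZMod q) ≠ 0 := by
    exact_mod_cast ZMod.prime_ne_zero q 2 h2
  have hz13 : ((13 : ℤ) : ZMod q) ≠ 0 := by
    exact_mod_cast ZMod.prime_ne_zero q 13 h13
  by_cases s2 : IsSquare ((2 : ℤ) : ZMod q)
  · exact Or.inl (mod_cast exists_padic_sq_eq_intCast_of_isSquare h2 hz2 s2)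
  by_cases s13 : IsSquare ((13 : ℤ) : ZMod q)
  · exact Or.inr (Or.inl (mod_cast exists_padic_sq_eq_intCast_of_isSquare h2 hz13 s13))
  have hz26 : ((2 * 13 : ℤ) : ZMod q) ≠ 0 := by
    rw [Int.cast_mul]
    exact mul_ne_zero hz2 hz13
  have s26 : IsSquare ((2 * 13 : ℤ) : ZMod q) := by
    rw [← legendreSym.eq_one_iff q hz26, legendreSym.mul,
      (legendreSym.eq_neg_one_iff q).mpr s2, (legendreSym.eq_neg_one_iff q).mpr s13]
    norm_num
  exact Or.inr (Or.inr (mod_cast exists_padic_sq_eq_intCast_of_isSquare h2 hz26 s26))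


/-- The surface `Y_{13,2,6} : y² − 13x² = uv, z² − 13x² = (2u−13v)(u−6v)`
has points over `ℝ` and over every `ℚ_q`, but no rational points: it fails the Hasse
principle. -/
theorem stmt_18 :
    (∃ u v x y z : ℝ,
      ¬ (u = 0 ∧ v = 0 ∧ x = 0 ∧ y = 0 ∧ z = 0) ∧
      y ^ 2 - 13 * x ^ 2 = u * v ∧
      z ^ 2 - 13 * x ^ 2 = (2 * u - 13 * v) * (u - 6 * v)) ∧
    (∀ (q : ℕ) [Fact q.Prime], ∃ u v x y z : ℚ_[q],
      ¬ (u = 0 ∧ v = 0 ∧ x = 0 ∧ y = 0 ∧ z = 0) ∧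
      y ^ 2 - 13 * x ^ 2 = u * v ∧
      z ^ 2 - 13 * x ^ 2 = (2 * u - 13 * v) * (u - 6 * v)) ∧
    ¬ ∃ u v x y z : ℚ,
      ¬ (u = 0 ∧ v = 0 ∧ x = 0 ∧ y = 0 ∧ z = 0) ∧
      y ^ 2 - 13 * x ^ 2 = u * v ∧
      z ^ 2 - 13 * x ^ 2 = (2 * u - 13 * v) * (u - 6 * v) := by
  refine ⟨⟨0, 0, 1, √13, √13, by simp, by simp, by simp⟩, ?_, ?_⟩
  · intro q hq
    by_cases h2 : q = 2
    · subst h2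
      obtain ⟨w, hw⟩ : ∃ w : ℚ_[2], w ^ 2 = (3129 : ℤ) := by
        refine exists_padic_sq_eq_intCast (a := 1) ?_
        have h2 : ‖((2 * 1 : ℤ) : ℤ_[2])‖ = 2⁻¹ := by
          simpa using PadicInt.norm_p (p := 2)
        have h8 := (PadicInt.norm_int_le_pow_iff_dvd (p := 2) (k := 1 ^ 2 - 3129) (n := 3)).mpr
          (by norm_num)
        rw [h2]
        refine h8.trans_lt ?_
        norm_num
      refine ⟨2, -6, 1, 1, w, by simp, by norm_num, ?_⟩
      rw [hw]
      norm_num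
    by_cases h13 : q = 13
    · subst h13
      obtain ⟨w, hw⟩ : ∃ w : ℚ_[13], w ^ 2 = (55 : ℤ) :=
        exists_padic_sq_eq_intCast_of_isSquare h2
          (by rw [Ne, ZMod.intCast_zmod_eq_zero_iff_dvd]; norm_num) ⟨4, rfl⟩
      refine ⟨1, 1, 0, 1, w, by simp, by norm_num, ?_⟩
      rw [hw]
      norm_num
    rcases exists_padic_sq_eq_two_or_thirteen_or_twentySix h2 h13 with
      ⟨w, hw⟩ | ⟨w, hw⟩ | ⟨w, hw⟩
    · exact ⟨1, 0, 0, 0, w, by simp, by norm_num, by rw [hw]; norm_num⟩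
    · exact ⟨0, 0, 1, w, w, by simp, by rw [hw]; norm_num, by rw [hw]; norm_num⟩
    · exact ⟨13, 2, 0, w, 0, by simp, by rw [hw]; norm_num, by norm_num⟩
  · rintro ⟨u, v, x, y, z, h0, h1, h2⟩
    exact h0 (eq_zero_of_system_rat h1 h2)
end

section
/- Consider the system y² − 13·x² = u·v, z² − 13·x² = (u + v)(153u + 179v). There is a nonzero vector in ℝ^5 satisfying both equations, and for every prime q there is a nonzero vector in ℚ_q^5 satisfying both equations, but there is no nonzero vector in ℚ^5 satisfying both equations. (Thus the quartic del Pezzo surface S_{13,153,179}, whose Brauer group modulo constants has order 4, fails the Hasse principle; the failure is explained by a Brauer–Manin obstruction coming from ℬ = (13, (y+z)/u).) -/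
lemma isSquare_padic_of_norm_lt {q : ℕ} [Fact q.Prime] (d a : ℤ)
    (h : ‖((a ^ 2 - d : ℤ) : ℤ_[q])‖ < ‖((2 * a : ℤ) : ℤ_[q])‖ ^ 2) :
    ∃ r : ℚ_[q], r ^ 2 = d := by
  have key := hensels_lemma (p := q) (R := ℤ) (F := Polynomial.X ^ 2 - Polynomial.C d)
    (a := (a : ℤ_[q])) (by
      simp only [Polynomial.derivative_X_pow, Polynomial.derivative_C,
        map_sub, map_mul, map_pow, Polynomial.aeval_X, Polynomial.aeval_C]
      push_cast at h
      simpa using h)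
  obtain ⟨z, hz, -⟩ := key
  refine ⟨z, ?_⟩
  have hz' : z ^ 2 = (d : ℤ_[q]) := by
    simpa [sub_eq_zero] using hz
  exact_mod_cast congrArg (fun t : ℤ_[q] => (t : ℚ_[q])) hz'

lemma exists_sq_eq_padic_of_isSquare_zmod {q : ℕ} [Fact q.Prime] (hq : q ≠ 2) (d : ℤ)
    (hd : ¬ (q : ℤ) ∣ d) (h : IsSquare (d : ZMod q)) : ∃ r : ℚ_[q], r ^ 2 = d := by
  have hp : q.Prime := Fact.out
  obtain ⟨b, hb⟩ := h
  obtain ⟨a, rfl⟩ := ZMod.intCast_surjective b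
  have ha : (a : ZMod q) ≠ 0 := by
    intro h0
    simp [h0] at hb
    rw [ZMod.intCast_zmod_eq_zero_iff_dvd] at hb
    exact hd hb
  refine isSquare_padic_of_norm_lt d a ?_
  have h2 : ((2 : ℤ) : ZMod q) ≠ 0 := by
    rw [Ne, ZMod.intCast_zmod_eq_zero_iff_dvd]
    intro hdvd
    have : q ∣ 2 := by exact_mod_cast hdvd
    exact hq ((Nat.prime_dvd_prime_iff_eq hp Nat.prime_two).1 this)
  have h2a : ‖((2 * a : ℤ) : ℤ_[q])‖ = 1 := by
    refine le_antisymm (PadicInt.norm_le_one _) (not_lt.1 ?_)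
    rw [PadicInt.norm_intCast_lt_one_iff, ← ZMod.intCast_zmod_eq_zero_iff_dvd]
    push_cast at h2 ⊢
    exact mul_ne_zero h2 ha
  rw [h2a, one_pow, PadicInt.norm_intCast_lt_one_iff, ← ZMod.intCast_zmod_eq_zero_iff_dvd]
  push_cast
  rw [hb]
  ring

lemma local_solution (q : ℕ) [Fact q.Prime] : ∃ u v x y z : ℚ_[q],
      ¬ (u = 0 ∧ v = 0 ∧ x = 0 ∧ y = 0 ∧ z = 0) ∧
      y ^ 2 - 13 * x ^ 2 = u * v ∧
      z ^ 2 - 13 * x ^ 2 = (u + v) * (153 * u + 179 * v) := by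
  have hp : q.Prime := Fact.out
  have sol13 : (∃ r : ℚ_[q], r ^ 2 = (13 : ℤ)) → ∃ u v x y z : ℚ_[q],
      ¬ (u = 0 ∧ v = 0 ∧ x = 0 ∧ y = 0 ∧ z = 0) ∧
      y ^ 2 - 13 * x ^ 2 = u * v ∧
      z ^ 2 - 13 * x ^ 2 = (u + v) * (153 * u + 179 * v) := by
    rintro ⟨r, hr⟩
    push_cast at hr
    exact ⟨0, 0, 1, r, r, by simp, by rw [hr]; ring, by rw [hr]; ring⟩
  have sol3 : (∃ r : ℚ_[q], r ^ 2 = (3 : ℤ)) → ∃ u v x y z : ℚ_[q],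
      ¬ (u = 0 ∧ v = 0 ∧ x = 0 ∧ y = 0 ∧ z = 0) ∧
      y ^ 2 - 13 * x ^ 2 = u * v ∧
      z ^ 2 - 13 * x ^ 2 = (u + v) * (153 * u + 179 * v) := by
    rintro ⟨r, hr⟩
    push_cast at hr
    exact ⟨1, -25, 14, 29 * r, 326, by simp, by rw [mul_pow, hr]; norm_num, by norm_num⟩
  by_cases q2 : q = 2
  · subst q2
    obtain ⟨r, hr⟩ := isSquare_padic_of_norm_lt (q := 2) 17 1 (by
      have h2 : ‖(2 : ℤ_[2])‖ = 2⁻¹ := by simpa using PadicInt.norm_p (p := 2)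
      have e : (((1 : ℤ) ^ 2 - 17 : ℤ) : ℤ_[2]) = -(2 ^ 4) := by norm_num
      rw [e, norm_neg, norm_pow]
      simp only [mul_one, Int.cast_ofNat, h2]
      norm_num)
    push_cast at hr
    exact ⟨1, 0, 0, 0, 3 * r, by simp, by norm_num, by rw [mul_pow, hr]; norm_num⟩
  by_cases q3 : q = 3
  · have h : IsSquare ((13 : ℤ) : ZMod 3) := by decide
    subst q3
    exact sol13 (exists_sq_eq_padic_of_isSquare_zmod q2 13 (by norm_num) h)
  by_cases q13 : q = 13
  · have h : IsSquare ((3 : ℤ) : ZMod 13) := by decide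
    subst q13
    exact sol3 (exists_sq_eq_padic_of_isSquare_zmod q2 3 (by norm_num) h)
  have h3 : ¬ (q : ℤ) ∣ 3 := fun h =>
    q3 ((Nat.prime_dvd_prime_iff_eq hp Nat.prime_three).1 (by exact_mod_cast h))
  have h13 : ¬ (q : ℤ) ∣ 13 := fun h =>
    q13 ((Nat.prime_dvd_prime_iff_eq hp (by norm_num)).1 (by exact_mod_cast h))
  have h39 : ¬ (q : ℤ) ∣ 39 := fun h =>
    ((Nat.prime_iff_prime_int.1 hp).dvd_or_dvd (show (q : ℤ) ∣ 3 * 13 by simpa using h)).elim h3 h13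
  by_cases s13 : IsSquare ((13 : ℤ) : ZMod q)
  · exact sol13 (exists_sq_eq_padic_of_isSquare_zmod q2 13 h13 s13)
  by_cases s3 : IsSquare ((3 : ℤ) : ZMod q)
  · exact sol3 (exists_sq_eq_padic_of_isSquare_zmod q2 3 h3 s3)
  obtain ⟨r, hr⟩ := exists_sq_eq_padic_of_isSquare_zmod q2 39 h39 (by
    rw [← legendreSym.eq_neg_one_iff] at s13 s3
    rw [← legendreSym.eq_one_iff q (by rwa [Ne, ZMod.intCast_zmod_eq_zero_iff_dvd]),
      show (39 : ℤ) = 3 * 13 by norm_num, legendreSym.mul, s13, s3]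
    norm_num)
  push_cast at hr
  exact ⟨26, -23, 11, 5 * r, 34, by simp, by rw [mul_pow, hr]; norm_num, by norm_num⟩

/-- The principal form `s² + st - 3t²` of discriminant `13` is anisotropic modulo `l`, which for a
prime `l` means that `l` is inert in `ℚ(√13)`. -/
def AnisotropicMod (l : ℕ) : Prop :=
  ∀ s t : ℤ, (l : ℤ) ∣ s ^ 2 + s * t - 3 * t ^ 2 → (l : ℤ) ∣ s ∧ (l : ℤ) ∣ t

lemma anisotropicMod_two : AnisotropicMod 2 := by
  intro s t h
  have key : ∀ s t : ZMod 2, s ^ 2 + s * t - 3 * t ^ 2 = 0 → s = 0 ∧ t = 0 := by decide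
  rw [← ZMod.intCast_zmod_eq_zero_iff_dvd] at h ⊢
  rw [← ZMod.intCast_zmod_eq_zero_iff_dvd]
  push_cast at h
  exact key _ _ h

lemma anisotropicMod_of_not_isSquare {l : ℕ} [Fact l.Prime]
    (h : ¬ IsSquare ((13 : ℕ) : ZMod l)) : AnisotropicMod l := by
  intro s t hst
  rw [← ZMod.intCast_zmod_eq_zero_iff_dvd] at hst ⊢
  rw [← ZMod.intCast_zmod_eq_zero_iff_dvd]
  push_cast at hst
  have ht : (t : ZMod l) = 0 := by
    by_contra ht
    refine h ⟨(2 * s + t) / t, ?_⟩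
    rw [div_mul_div_comm, eq_div_iff (mul_ne_zero ht ht)]
    push_cast
    linear_combination (-4) * hst
  refine ⟨?_, ht⟩
  rw [ht] at hst
  simpa using hst

lemma even_padicValInt_principalForm {l : ℕ} [Fact l.Prime] (hl : AnisotropicMod l) (s t : ℤ)
    (h : s ^ 2 + s * t - 3 * t ^ 2 ≠ 0) : Even (padicValInt l (s ^ 2 + s * t - 3 * t ^ 2)) := by
  have hp : l.Prime := Fact.out
  have hl0 : (l : ℤ) ≠ 0 := by exact_mod_cast hp.ne_zero
  induction hn : (s ^ 2 + s * t - 3 * t ^ 2).natAbs using Nat.strong_induction_on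
    generalizing s t with
  | _ n ih =>
    by_cases hd : (l : ℤ) ∣ s ^ 2 + s * t - 3 * t ^ 2
    · obtain ⟨⟨s, rfl⟩, ⟨t, rfl⟩⟩ := hl s t hd
      have e : ((l : ℤ) * s) ^ 2 + (l * s) * (l * t) - 3 * (l * t) ^ 2
          = l * (l * (s ^ 2 + s * t - 3 * t ^ 2)) := by ring
      rw [e] at h hn ⊢
      have h0 := right_ne_zero_of_mul (right_ne_zero_of_mul h)
      have hlt : (s ^ 2 + s * t - 3 * t ^ 2).natAbs < n := by
        rw [← hn, Int.natAbs_mul, Int.natAbs_mul, Int.natAbs_natCast, ← mul_assoc]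
        have : 0 < (s ^ 2 + s * t - 3 * t ^ 2).natAbs := Int.natAbs_pos.2 h0
        have := hp.two_le
        nlinarith [Nat.mul_le_mul this this]
      have := ih _ hlt s t h0 rfl
      rw [padicValInt.mul hl0 (mul_ne_zero hl0 h0), padicValInt.mul hl0 h0, padicValInt_self]
      grind
    · rw [padicValInt.eq_zero_of_not_dvd hd]
      exact Even.zero

lemma eq_zero_of_sq_eq_prime_mul_sq {p : ℕ} (hp : p.Prime) {s x : ℤ} (h : s ^ 2 = p * x ^ 2) :
    s = 0 ∧ x = 0 := by
  have hx : x = 0 := by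
    by_contra hx
    refine (irrational_iff_ne_rational _).1 hp.irrational_sqrt |s| |x| (by simpa using hx) ?_
    have h' : (s : ℝ) ^ 2 = p * (x : ℝ) ^ 2 := by exact_mod_cast h
    have hx' : (x : ℝ) ≠ 0 := by exact_mod_cast hx
    push_cast
    rw [← abs_div, ← Real.sqrt_sq_eq_abs, div_pow, h', mul_div_assoc, div_self (by positivity),
      mul_one]
  subst hx
  simpa using h

lemma principalForm_eq_zero {s t : ℤ} (h : s ^ 2 + s * t - 3 * t ^ 2 = 0) : s = 0 ∧ t = 0 := by
  have := eq_zero_of_sq_eq_prime_mul_sq (p := 13) (by norm_num) (s := 2 * s + t) (x := t)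
    (by push_cast; linarith)
  lia

lemma isSquare_zmod_thirteen {n : ℤ} (hn : n ≠ 0)
    (h : ∀ l : ℕ, l.Prime → AnisotropicMod l → Even (padicValInt l n)) :
    IsSquare (n : ZMod 13) := by
  have hneg : IsSquare (-1 : ZMod 13) := by decide
  have : Fact (Nat.Prime 13) := ⟨by norm_num⟩
  have hpow : ∀ l ∈ n.natAbs.primeFactors,
      IsSquare ((l : ZMod 13) ^ n.natAbs.factorization l) := by
    intro l hl
    have hp := Nat.prime_of_mem_primeFactors hl
    have : Fact l.Prime := ⟨hp⟩
    by_cases hs : IsSquare (l : ZMod 13)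
    · exact hs.pow _
    have hani : AnisotropicMod l := by
      by_cases h2 : l = 2
      · exact h2 ▸ anisotropicMod_two
      · rw [ZMod.exists_sq_eq_prime_iff_of_mod_four_eq_one (by norm_num) h2] at hs
        exact anisotropicMod_of_not_isSquare hs
    have := h l hp hani
    rw [padicValInt, ← Nat.factorization_def _ hp] at this
    exact this.isSquare_pow _
  have habs : IsSquare (n.natAbs : ZMod 13) := by
    rw [← Nat.prod_factorization_pow_eq_self (Int.natAbs_ne_zero.2 hn), Finsupp.prod]
    push_cast
    exact Finset.isSquare_prod _ hpow
  rcases Int.natAbs_eq n with e | e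
  · rw [e, Int.cast_natCast]
    exact habs
  · rw [e, Int.cast_neg, Int.cast_natCast, neg_eq_neg_one_mul]
    exact hneg.mul habs

/-- Integral points of `S_{13,153,179}` with coprime coordinates. -/
structure IsPrimitivePoint (u v x y z : ℤ) : Prop where
  first : y ^ 2 - 13 * x ^ 2 = u * v
  second : z ^ 2 - 13 * x ^ 2 = (u + v) * (153 * u + 179 * v)
  coprime : ∀ p : ℕ, p.Prime →
    ¬ ((p : ℤ) ∣ u ∧ (p : ℤ) ∣ v ∧ (p : ℤ) ∣ x ∧ (p : ℤ) ∣ y ∧ (p : ℤ) ∣ z)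

namespace IsPrimitivePoint

variable {u v x y z : ℤ}

lemma neg_y (h : IsPrimitivePoint u v x y z) : IsPrimitivePoint u v x (-y) z :=
  ⟨by simpa using h.first, h.second, by simpa using h.coprime⟩

lemma neg_z (h : IsPrimitivePoint u v x y z) : IsPrimitivePoint u v x y (-z) :=
  ⟨h.first, by simpa using h.second, by simpa using h.coprime⟩

lemma first_eq_principalForm (h : IsPrimitivePoint u v x y z) :
    u * v = (y - x) ^ 2 + (y - x) * (2 * x) - 3 * (2 * x) ^ 2 := by
  linear_combination -h.first

lemma mul_eq_principalForm (h : IsPrimitivePoint u v x y z) :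
    (y + z) * (y - z) =
      -((12 * u + 13 * v) ^ 2 + (12 * u + 13 * v) * (u + v) - 3 * (u + v) ^ 2) := by
  linear_combination h.first - h.second

lemma not_even_even (h : IsPrimitivePoint u v x y z) : ¬ (2 ∣ u ∧ 2 ∣ v) := by
  rintro ⟨⟨u', rfl⟩, ⟨v', rfl⟩⟩
  have key : ∀ a b x y z : ZMod 8, y ^ 2 - 13 * x ^ 2 = 2 * a * (2 * b) →
      z ^ 2 - 13 * x ^ 2 = (2 * a + 2 * b) * (153 * (2 * a) + 179 * (2 * b)) →
      4 * x = 0 ∧ 4 * y = 0 ∧ 4 * z = 0 := by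
    have key₁ : ∀ x y c : ZMod 8, y ^ 2 - 13 * x ^ 2 = 4 * c →
      (4 * x = 0 ∧ 4 * y = 0) ∨ (4 * c = 4 ∧ x ^ 2 = 1) := by decide
    have key₂ : ∀ a b : ZMod 8, 4 * (a * b) = 4 →
      (2 * a + 2 * b) * (153 * (2 * a) + 179 * (2 * b)) = 0 := by decide
    have key₃ : ∀ z : ZMod 8, z ^ 2 - 13 ≠ 0 := by decide
    have key₄ : ∀ x z c : ZMod 8, 4 * x = 0 → z ^ 2 - 13 * x ^ 2 = 4 * c → 4 * z = 0 := by decide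
    intro a b x y z h₁ h₂
    rcases key₁ x y (a * b) (by rw [h₁]; ring) with ⟨hx, hy⟩ | ⟨hc, hx⟩
    · exact ⟨hx, hy, key₄ x z ((a + b) * (153 * a + 179 * b)) hx (by rw [h₂]; ring)⟩
    · rw [key₂ a b hc, hx, mul_one] at h₂
      exact absurd h₂ (key₃ z)
  have h₁ := congrArg (Int.cast : ℤ → ZMod 8) h.first
  have h₂ := congrArg (Int.cast : ℤ → ZMod 8) h.second
  push_cast at h₁ h₂
  obtain ⟨hx, hy, hz⟩ := key _ _ _ _ _ h₁ h₂
  have even : ∀ w : ℤ, 4 * (w : ZMod 8) = 0 → (2 : ℤ) ∣ w := by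
    intro w hw
    have : ((4 * w : ℤ) : ZMod 8) = 0 := by push_cast; exact hw
    rw [ZMod.intCast_zmod_eq_zero_iff_dvd] at this
    push_cast at this
    lia
  exact h.coprime 2 Nat.prime_two
    ⟨⟨u', rfl⟩, ⟨v', rfl⟩, even _ hx, even _ hy, even _ hz⟩

lemma not_dvd_dvd (h : IsPrimitivePoint u v x y z) {l : ℕ} (hp : l.Prime) (hl : AnisotropicMod l) :
    ¬ ((l : ℤ) ∣ u ∧ (l : ℤ) ∣ v) := by
  rintro ⟨hu, hv⟩
  by_cases h2 : l = 2
  · subst h2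
    exact h.not_even_even ⟨hu, hv⟩
  have hlp := Nat.prime_iff_prime_int.1 hp
  obtain ⟨hyx, h2x⟩ := hl (y - x) (2 * x) (h.first_eq_principalForm ▸ hu.mul_right v)
  have hx : (l : ℤ) ∣ x := (hlp.dvd_or_dvd h2x).resolve_left fun h' =>
    h2 ((Nat.prime_dvd_prime_iff_eq hp Nat.prime_two).1 (by exact_mod_cast h'))
  have hy : (l : ℤ) ∣ y := by simpa using dvd_add hyx hx
  have hz : (l : ℤ) ∣ z := by
    refine hlp.dvd_of_dvd_pow (n := 2) ?_
    rw [show z ^ 2 = (u + v) * (153 * u + 179 * v) + x * (13 * x) by linear_combination h.second]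
    exact dvd_add ((dvd_add hu hv).mul_right _) (hx.mul_right _)
  exact h.coprime l hp ⟨hu, hv, hx, hy, hz⟩

lemma not_eq_zero_eq_zero (h : IsPrimitivePoint u v x y z) : ¬ (u = 0 ∧ v = 0) := by
  rintro ⟨rfl, rfl⟩
  exact h.not_even_even ⟨dvd_zero 2, dvd_zero 2⟩

lemma mul_ne_zero (h : IsPrimitivePoint u v x y z) : u * v ≠ 0 := by
  intro huv
  obtain ⟨hyx, h2x⟩ := principalForm_eq_zero (h.first_eq_principalForm ▸ huv)
  obtain rfl : x = 0 := by lia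
  obtain rfl : y = 0 := by lia
  have hz := h.second
  rcases mul_eq_zero.1 huv with rfl | rfl
  · exact h.not_eq_zero_eq_zero ⟨rfl, (eq_zero_of_sq_eq_prime_mul_sq (p := 179) (by norm_num)
      (s := z) (by push_cast; linear_combination hz)).2⟩
  · have := (eq_zero_of_sq_eq_prime_mul_sq (p := 17) (by norm_num) (s := z) (x := 3 * u)
      (by push_cast; linear_combination hz)).2
    exact h.not_eq_zero_eq_zero ⟨by lia, rfl⟩

lemma add_mul_sub_ne_zero (h : IsPrimitivePoint u v x y z) : (y + z) * (y - z) ≠ 0 := by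
  rw [h.mul_eq_principalForm, neg_ne_zero]
  intro h0
  obtain ⟨hs, ht⟩ := principalForm_eq_zero h0
  exact h.not_eq_zero_eq_zero (by lia)

lemma dvd_of_not_even {l : ℕ} {n : ℤ} (h : ¬ Even (padicValInt l n)) : (l : ℤ) ∣ n := by
  by_contra hn
  exact h (padicValInt.eq_zero_of_not_dvd hn ▸ Even.zero)

lemma even_padicValInt_coord (h : IsPrimitivePoint u v x y z) {l : ℕ} (hp : l.Prime)
    (hl : AnisotropicMod l) : Even (padicValInt l u) ∧ Even (padicValInt l v) := by
  have : Fact l.Prime := ⟨hp⟩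
  have heven : Even (padicValInt l (u * v)) := by
    have h0 := h.mul_ne_zero
    rw [h.first_eq_principalForm] at h0 ⊢
    exact even_padicValInt_principalForm hl _ _ h0
  rw [padicValInt.mul (left_ne_zero_of_mul h.mul_ne_zero) (right_ne_zero_of_mul h.mul_ne_zero),
    Nat.even_add] at heven
  by_contra hcon
  refine h.not_dvd_dvd hp hl ⟨dvd_of_not_even fun hu => ?_, dvd_of_not_even fun hv => ?_⟩
  · exact hcon ⟨hu, heven.1 hu⟩
  · exact hcon ⟨heven.2 hv, hv⟩

lemma even_padicValInt_add (h : IsPrimitivePoint u v x y z) {l : ℕ} (hp : l.Prime)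
    (hl : AnisotropicMod l) : Even (padicValInt l (y + z)) := by
  have : Fact l.Prime := ⟨hp⟩
  by_contra hodd
  have hdvd := (dvd_of_not_even hodd).mul_right (y - z)
  rw [h.mul_eq_principalForm, dvd_neg] at hdvd
  obtain ⟨⟨s, hs⟩, ⟨t, ht⟩⟩ := hl _ _ hdvd
  exact h.not_dvd_dvd hp hl ⟨⟨13 * t - s, by linear_combination 13 * ht - hs⟩,
    ⟨s - 12 * t, by linear_combination hs - 12 * ht⟩⟩

lemma thirteen_dvd_add (h : IsPrimitivePoint u v x y z) (hz : (13 : ℤ) ∣ 2 * z - (u + v)) {w : ℤ}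
    (hw : w = u ∨ w = v) : (13 : ℤ) ∣ w + y := by
  have t13 : (13 : ZMod 13) = 0 := by decide
  have nonsq : ∀ n m : ZMod 13, 2 * (n * n) = m ^ 2 → n = 0 := by decide
  have : Fact (Nat.Prime 13) := ⟨by norm_num⟩
  have dvd_iff : ∀ n : ℤ, (13 : ℤ) ∣ n ↔ (n : ZMod 13) = 0 := fun n =>
    (ZMod.intCast_zmod_eq_zero_iff_dvd n 13).symm
  have hsq : (2 : ZMod 13) * ((y + z) * w) = (w + y) ^ 2 := by
    have h₁ := congrArg (Int.cast : ℤ → ZMod 13) h.first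
    rw [dvd_iff] at hz
    push_cast at h₁ hz
    rw [t13] at h₁
    rcases hw with rfl | rfl
    · linear_combination (w : ZMod 13) * hz - h₁
    · linear_combination (w : ZMod 13) * hz - h₁
  by_contra hwy
  rw [dvd_iff] at hwy
  push_cast at hwy
  have hw0 : w ≠ 0 := by
    rcases hw with rfl | rfl
    · exact left_ne_zero_of_mul h.mul_ne_zero
    · exact right_ne_zero_of_mul h.mul_ne_zero
  have hyz0 := left_ne_zero_of_mul h.add_mul_sub_ne_zero
  have hn : ((y : ZMod 13) + z) * w ≠ 0 := by
    intro h0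
    rw [h0, mul_zero] at hsq
    exact hwy (by simpa using hsq.symm)
  have hsquare : IsSquare (((y + z) * w : ℤ) : ZMod 13) := by
    refine isSquare_zmod_thirteen (_root_.mul_ne_zero hyz0 hw0) fun l hp hl => ?_
    have : Fact l.Prime := ⟨hp⟩
    rw [padicValInt.mul hyz0 hw0]
    refine (h.even_padicValInt_add hp hl).add ?_
    rcases hw with rfl | rfl
    · exact (h.even_padicValInt_coord hp hl).1
    · exact (h.even_padicValInt_coord hp hl).2
  push_cast at hsquare
  obtain ⟨r, hr⟩ := hsquare
  rw [hr] at hsq hn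
  exact hn (by simp [nonsq _ _ hsq])

lemma not_thirteen_dvd (h : IsPrimitivePoint u v x y z) : ¬ (13 : ℤ) ∣ 2 * z - (u + v) := by
  intro hz
  have h₁ := h.thirteen_dvd_add hz (.inl rfl)
  have h₂ := h.thirteen_dvd_add hz (.inr rfl)
  have h₃ := h.neg_y.thirteen_dvd_add hz (.inl rfl)
  have h₄ := h.neg_y.thirteen_dvd_add hz (.inr rfl)
  have hu : (13 : ℤ) ∣ u := by lia
  have hv : (13 : ℤ) ∣ v := by lia
  have hy : (13 : ℤ) ∣ y := by lia
  have hz' : (13 : ℤ) ∣ z := by lia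
  have hx : (13 : ℤ) ∣ x := by
    have hp : Prime (13 : ℤ) := by norm_num
    refine hp.dvd_of_dvd_pow (n := 2) ?_
    obtain ⟨a, rfl⟩ := hu
    obtain ⟨b, rfl⟩ := hv
    obtain ⟨c, rfl⟩ := hy
    exact ⟨c ^ 2 - a * b, by linarith [h.first]⟩
  exact h.coprime 13 (by norm_num) ⟨hu, hv, hx, hy, hz'⟩

end IsPrimitivePoint

lemma not_isPrimitivePoint (u v x y z : ℤ) : ¬ IsPrimitivePoint u v x y z := by
  intro h
  have hp : Prime (13 : ℤ) := by norm_num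
  have hdvd : (13 : ℤ) ∣ (2 * z - (u + v)) * (2 * (-z) - (u + v)) :=
    ⟨-(4 * x ^ 2 + (u + v) * (47 * u + 55 * v)), by linear_combination (-4) * h.second⟩
  exact (hp.dvd_or_dvd hdvd).elim h.not_thirteen_dvd h.neg_z.not_thirteen_dvd

lemma exists_isPrimitivePoint_of_rat {u v x y z : ℚ}
    (h0 : ¬ (u = 0 ∧ v = 0 ∧ x = 0 ∧ y = 0 ∧ z = 0))
    (h₁ : y ^ 2 - 13 * x ^ 2 = u * v)
    (h₂ : z ^ 2 - 13 * x ^ 2 = (u + v) * (153 * u + 179 * v)) :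
    ∃ u v x y z : ℤ, IsPrimitivePoint u v x y z := by
  obtain ⟨d, hd⟩ := IsLocalization.exist_integer_multiples_of_finset (nonZeroDivisors ℤ)
    ({u, v, x, y, z} : Finset ℚ)
  have hd0 : (d : ℤ) ≠ 0 := nonZeroDivisors.coe_ne_zero d
  have hdq : ((d : ℤ) : ℚ) ≠ 0 := by exact_mod_cast hd0
  have hint : ∀ r ∈ ({u, v, x, y, z} : Finset ℚ), ∃ n : ℤ, (n : ℚ) = (d : ℤ) * r := by
    intro r hr
    obtain ⟨n, hn⟩ := hd r hr
    exact ⟨n, by simpa [Algebra.smul_def] using hn⟩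
  obtain ⟨a, ha⟩ := hint u (by simp)
  obtain ⟨b, hb⟩ := hint v (by simp)
  obtain ⟨c, hc⟩ := hint x (by simp)
  obtain ⟨e, he⟩ := hint y (by simp)
  obtain ⟨f, hf⟩ := hint z (by simp)
  obtain ⟨g, hg, hgcd⟩ := Finset.univ.extract_gcd ![a, b, c, e, f] Finset.univ_nonempty
  set k := Finset.univ.gcd ![a, b, c, e, f]
  have ea : a = k * g 0 := hg 0 (Finset.mem_univ _)
  have eb : b = k * g 1 := hg 1 (Finset.mem_univ _)
  have ec : c = k * g 2 := hg 2 (Finset.mem_univ _)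
  have ee : e = k * g 3 := hg 3 (Finset.mem_univ _)
  have ef : f = k * g 4 := hg 4 (Finset.mem_univ _)
  have hk : k ≠ 0 := by
    intro hk
    simp only [hk, zero_mul] at ea eb ec ee ef
    subst ea eb ec ee ef
    simp_all
  refine ⟨g 0, g 1, g 2, g 3, g 4, ?_, ?_, ?_⟩
  · have : e ^ 2 - 13 * c ^ 2 = a * b := by
      have : (e : ℚ) ^ 2 - 13 * c ^ 2 = a * b := by
        rw [ha, hb, hc, he]
        linear_combination ((d : ℤ) : ℚ) ^ 2 * h₁
      exact_mod_cast this
    rw [ea, eb, ec, ee] at this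
    exact mul_left_cancel₀ (pow_ne_zero 2 hk) (by linear_combination this)
  · have : f ^ 2 - 13 * c ^ 2 = (a + b) * (153 * a + 179 * b) := by
      have : (f : ℚ) ^ 2 - 13 * c ^ 2 = (a + b) * (153 * a + 179 * b) := by
        rw [ha, hb, hc, hf]
        linear_combination ((d : ℤ) : ℚ) ^ 2 * h₂
      exact_mod_cast this
    rw [ea, eb, ec, ef] at this
    exact mul_left_cancel₀ (pow_ne_zero 2 hk) (by linear_combination this)
  · rintro p hp ⟨h0, h1, h2, h3, h4⟩
    have : (p : ℤ) ∣ Finset.univ.gcd g := by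
      refine Finset.dvd_gcd fun i _ => ?_
      fin_cases i <;> assumption
    rw [hgcd] at this
    exact (Nat.prime_iff_prime_int.1 hp).not_dvd_one this

/-- The surface
`S_{13,153,179} : y² − 13x² = uv, z² − 13x² = (u+v)(153u+179v)` has points over `ℝ`
and over every `ℚ_q`, but no rational points: it fails the Hasse principle. -/
theorem stmt_19 :
    (∃ u v x y z : ℝ,
      ¬ (u = 0 ∧ v = 0 ∧ x = 0 ∧ y = 0 ∧ z = 0) ∧
      y ^ 2 - 13 * x ^ 2 = u * v ∧
      z ^ 2 - 13 * x ^ 2 = (u + v) * (153 * u + 179 * v)) ∧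
    (∀ (q : ℕ) [Fact q.Prime], ∃ u v x y z : ℚ_[q],
      ¬ (u = 0 ∧ v = 0 ∧ x = 0 ∧ y = 0 ∧ z = 0) ∧
      y ^ 2 - 13 * x ^ 2 = u * v ∧
      z ^ 2 - 13 * x ^ 2 = (u + v) * (153 * u + 179 * v)) ∧
    ¬ ∃ u v x y z : ℚ,
      ¬ (u = 0 ∧ v = 0 ∧ x = 0 ∧ y = 0 ∧ z = 0) ∧
      y ^ 2 - 13 * x ^ 2 = u * v ∧
      z ^ 2 - 13 * x ^ 2 = (u + v) * (153 * u + 179 * v) := by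
  refine ⟨⟨1, 1, 0, 1, √664, by simp, by norm_num, ?_⟩, fun q _ => local_solution q, ?_⟩
  · rw [Real.sq_sqrt (by norm_num)]
    norm_num
  · rintro ⟨u, v, x, y, z, h0, h₁, h₂⟩
    obtain ⟨u, v, x, y, z, h⟩ := exists_isPrimitivePoint_of_rat h0 h₁ h₂
    exact not_isPrimitivePoint u v x y z h
end
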